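/- arXiv:2512.04236 — 4 statements merged into one kernel-verified Lean document; each statement's English description precedes it below -/
import Mathlib

section
/- Let γ > 1 be a real number and let T : [0,1] → [0,1] be the map T x = γx mod 1 (the fractional part of γx). Then for every y ∈ [0,1], the set {x ∈ [0,1] : liminf_{n→∞} |T^n x − y| > 0} has Hausdorff dimension 1. -/
/-- If an injective coding of a set by sequences of `M` digits separates any two codes first
differing at position `k` by at least `c * r ^ k`, then the coded set has dimension at least
`log M / log (1 / r)`. -/
theorem le_dimH_range_of_separated {X : Type*} [MetricSpace X] {M : ℕ} (hM : 1 < M)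
    (f : (ℕ → Fin M) → X) {r c : ℝ} (hr : 0 < r) (hc : 0 < c) {s : NNReal} (hs : 0 < s)
    (hMr : 1 ≤ M * r ^ (s : ℝ))
    (hsep : ∀ ω ω' k, (∀ i < k, ω i = ω' i) → ω k ≠ ω' k → c * r ^ k ≤ dist (f ω) (f ω')) :
    (s : ENNReal) ≤ dimH (Set.range f) := by
  have key : ∀ ω ω' : ℕ → Fin M, |Real.ofDigits ω - Real.ofDigits ω'| ≤
      (c ^ (s : ℝ))⁻¹ * dist (f ω) (f ω') ^ (s : ℝ) := by
    intro ω ω'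
    rcases eq_or_ne ω ω' with rfl | hne
    · simp only [sub_self, abs_zero]; positivity
    have hd := hsep ω ω' (PiNat.firstDiff ω ω')
      (fun i hi => PiNat.apply_eq_of_lt_firstDiff hi) (PiNat.apply_firstDiff_ne hne)
    have h1 := Real.abs_ofDigits_sub_ofDigits_le (x := ω) (y := ω') (n := PiNat.firstDiff ω ω')
      (fun i hi => PiNat.apply_eq_of_lt_firstDiff hi)
    set k := PiNat.firstDiff ω ω'
    have hM0 : (0 : ℝ) < M := by exact_mod_cast zero_lt_one.trans hM
    have h2 : (1 : ℝ) ≤ M ^ k * (r ^ k) ^ (s : ℝ) := by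
      rw [← Real.rpow_natCast_mul hr.le, mul_comm (k : ℝ), Real.rpow_mul_natCast hr.le,
        ← mul_pow]
      exact one_le_pow₀ hMr
    have h3 : ((M : ℝ) ^ k)⁻¹ ≤ (r ^ k) ^ (s : ℝ) := by
      rw [inv_le_iff_one_le_mul₀ (by positivity)]
      linarith [mul_comm ((M : ℝ) ^ k) ((r ^ k) ^ (s : ℝ))]
    have h4 : (c * r ^ k) ^ (s : ℝ) ≤ dist (f ω) (f ω') ^ (s : ℝ) :=
      Real.rpow_le_rpow (by positivity) hd s.2
    rw [Real.mul_rpow hc.le (by positivity)] at h4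
    have hcs : 0 < c ^ (s : ℝ) := by positivity
    calc _ ≤ _ := h1
      _ ≤ _ := h3
      _ = (c ^ (s : ℝ))⁻¹ * (c ^ (s : ℝ) * (r ^ k) ^ (s : ℝ)) := by field_simp
      _ ≤ _ := by gcongr
  have hinj : Function.Injective f := by
    intro ω ω' h
    by_contra hne
    have hd := hsep ω ω' (PiNat.firstDiff ω ω')
      (fun i hi => PiNat.apply_eq_of_lt_firstDiff hi) (PiNat.apply_firstDiff_ne hne)
    rw [h, dist_self] at hd
    exact absurd hd (not_le.2 (by positivity))
  have : Nonempty (ℕ → Fin M) := ⟨fun _ => ⟨0, zero_lt_one.trans hM⟩⟩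
  have hinv : ∀ ω, Function.invFun f (f ω) = ω := Function.leftInverse_invFun hinj
  have hol : HolderOnWith (Real.toNNReal (c ^ (s : ℝ))⁻¹) s
      (Real.ofDigits ∘ Function.invFun f) (Set.range f) := by
    rintro _ ⟨ω, rfl⟩ _ ⟨ω', rfl⟩
    simp only [Function.comp, hinv]
    rw [edist_dist, edist_dist,
      ENNReal.ofReal_rpow_of_nonneg dist_nonneg s.coe_nonneg,
      ← ENNReal.ofReal, ← ENNReal.ofReal_mul (by positivity)]
    exact ENNReal.ofReal_le_ofReal (key ω ω')
  have himg := hol.dimH_image_le hs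
  have hsub : Set.Icc (0 : ℝ) 1 ⊆ (Real.ofDigits ∘ Function.invFun f) '' Set.range f := by
    intro z hz
    obtain ⟨ω, -, rfl⟩ := Real.ofDigits_SurjOn hM hz
    exact ⟨f ω, ⟨ω, rfl⟩, by simp [hinv]⟩
  have hone : dimH (Set.Icc (0 : ℝ) 1) = 1 := by
    rw [Real.dimH_of_nonempty_interior (by simp)]
    simp
  have := hone.symm.le.trans ((dimH_mono hsub).trans himg)
  rw [ENNReal.le_div_iff_mul_le (by simp [hs.ne']) (by simp)] at this
  simpa using this

/-- The sum of the series with digits `a` and ratio `r`. -/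
noncomputable def digitSeries (r : ℝ) (a : ℕ → ℝ) : ℝ := ∑' k, r ^ k * a k

theorem summable_digitSeries {r : ℝ} (hr : 0 < r) (hr1 : r < 1) {a : ℕ → ℝ}
    (ha : ∀ k, 0 ≤ a k) {C : ℝ} (ha' : ∀ k, a k ≤ C) : Summable fun k => r ^ k * a k :=
  Summable.of_nonneg_of_le (fun k => mul_nonneg (by positivity) (ha k))
    (fun k => mul_le_mul_of_nonneg_left (ha' k) (by positivity))
    ((summable_geometric_of_lt_one hr.le hr1).mul_right C)

theorem digitSeries_succ {r : ℝ} (hr : 0 < r) (hr1 : r < 1) {a : ℕ → ℝ}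
    (ha : ∀ k, 0 ≤ a k) {C : ℝ} (ha' : ∀ k, a k ≤ C) :
    digitSeries r a = a 0 + r * digitSeries r (fun k => a (k + 1)) := by
  rw [digitSeries, (summable_digitSeries hr hr1 ha ha').tsum_eq_zero_add, digitSeries,
    ← tsum_mul_left]
  simp [pow_succ', mul_assoc]

theorem digitSeries_nonneg {r : ℝ} (hr : 0 < r) {a : ℕ → ℝ} (ha : ∀ k, 0 ≤ a k) :
    0 ≤ digitSeries r a := tsum_nonneg fun k => mul_nonneg (by positivity) (ha k)

theorem digitSeries_le {r : ℝ} (hr : 0 < r) (hr1 : r < 1) {a : ℕ → ℝ}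
    (ha : ∀ k, 0 ≤ a k) (ha' : ∀ k, a k ≤ 1 - 2 * r) : digitSeries r a ≤ 1 - r := by
  have h : digitSeries r a ≤ ∑' k, r ^ k * (1 - 2 * r) :=
    (summable_digitSeries hr hr1 ha ha').tsum_le_tsum
      (fun k => mul_le_mul_of_nonneg_left (ha' k) (by positivity))
      ((summable_geometric_of_lt_one hr.le hr1).mul_right _)
  rw [tsum_mul_right, tsum_geometric_of_lt_one hr.le hr1] at h
  refine h.trans ?_
  rw [inv_mul_le_iff₀ (by linarith)]
  nlinarith

/-- Two digit series whose digits first differ at position `k`, by at least `r`, are far apart. -/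
theorem le_dist_digitSeries {r : ℝ} (hr : 0 < r) (hr1 : r < 1) (k : ℕ) :
    ∀ {a b : ℕ → ℝ}, (∀ k, 0 ≤ a k) → (∀ k, a k ≤ 1 - 2 * r) →
    (∀ k, 0 ≤ b k) → (∀ k, b k ≤ 1 - 2 * r) → (∀ i < k, a i = b i) → r ≤ |a k - b k| →
    r ^ 2 * r ^ k ≤ dist (digitSeries r a) (digitSeries r b) := by
  induction k with
  | zero =>
    intro a b ha ha' hb hb' _ hk
    rw [Real.dist_eq, digitSeries_succ hr hr1 ha ha', digitSeries_succ hr hr1 hb hb']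
    have h1 := digitSeries_nonneg hr (fun k => ha (k + 1))
    have h2 := digitSeries_nonneg hr (fun k => hb (k + 1))
    have h3 := digitSeries_le hr hr1 (fun k => ha (k + 1)) (fun k => ha' (k + 1))
    have h4 := digitSeries_le hr hr1 (fun k => hb (k + 1)) (fun k => hb' (k + 1))
    generalize digitSeries r (fun k => a (k + 1)) = u at *
    generalize digitSeries r (fun k => b (k + 1)) = v at *
    have h5 : r * u ≤ r * (1 - r) := by gcongr
    have h6 : r * v ≤ r * (1 - r) := by gcongr
    have h7 : 0 ≤ r * u := by positivity
    have h8 : 0 ≤ r * v := by positivity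
    rcases le_abs'.1 hk with h | h
    · refine le_abs'.2 (Or.inl ?_); linarith
    · refine le_abs'.2 (Or.inr ?_); linarith
  | succ k ih =>
    intro a b ha ha' hb hb' hab hk
    have := ih (fun k => ha (k + 1)) (fun k => ha' (k + 1)) (fun k => hb (k + 1))
      (fun k => hb' (k + 1)) (fun i hi => hab (i + 1) (by omega)) hk
    rw [digitSeries_succ hr hr1 ha ha', digitSeries_succ hr hr1 hb hb', hab 0 (by omega),
      dist_add_left, Real.dist_eq, ← mul_sub, abs_mul, abs_of_pos hr, ← Real.dist_eq]
    calc _ = r * (r ^ 2 * r ^ k) := by ring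
      _ ≤ _ := by gcongr

/-- The map `x ↦ γ x mod 1` on the real line. -/
noncomputable def betaStep (γ x : ℝ) : ℝ := Int.fract (γ * x)

/-- `[a, a + γ⁻ⁿ)` is a full cylinder of rank `n`: the first `n` iterates of the map are affine
on it, and the `n`-th one maps it onto `[0, 1)`. -/
structure IsFullCylinder (γ : ℝ) (n : ℕ) (a : ℝ) : Prop where
  nonneg : 0 ≤ a
  add_le : a + (γ ^ n)⁻¹ ≤ 1
  iterate : ∀ j ≤ n, ∀ v, 0 ≤ v → v < (γ ^ n)⁻¹ →
    (betaStep γ)^[j] (a + v) = (betaStep γ)^[j] a + γ ^ j * v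
  iterate_left : (betaStep γ)^[n] a = 0

theorem betaStep_natCast_div_add {γ : ℝ} (hγ : 1 < γ) (i : ℕ) {v : ℝ} (hv : 0 ≤ v)
    (hv' : γ * v < 1) : betaStep γ (i / γ + v) = γ * v := by
  have : γ * (i / γ + v) = γ * v + i := by field_simp; ring
  rw [betaStep, this, Int.fract_add_natCast, Int.fract_eq_self]
  exact ⟨by positivity, hv'⟩

namespace IsFullCylinder

variable {γ : ℝ} {n m : ℕ} {a b : ℝ}

theorem zero_rank : IsFullCylinder γ 0 0 where
  nonneg := le_rfl
  add_le := by simp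
  iterate j hj v _ _ := by simp [Nat.le_zero.1 hj]
  iterate_left := rfl

theorem append (hγ : 1 < γ) (ha : IsFullCylinder γ n a) (hb : IsFullCylinder γ m b) :
    IsFullCylinder γ (n + m) (a + (γ ^ n)⁻¹ * b) := by
  have hn : 0 < γ ^ n := by positivity
  have hm : 0 < γ ^ m := by positivity
  have hb0 := hb.nonneg
  have hinv : (γ ^ (n + m))⁻¹ = (γ ^ n)⁻¹ * (γ ^ m)⁻¹ := by rw [pow_add, mul_inv]
  have hle : (γ ^ n)⁻¹ * (b + (γ ^ m)⁻¹) ≤ (γ ^ n)⁻¹ := mul_le_of_le_one_right (by positivity)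
    hb.add_le
  have hw0 : 0 ≤ (γ ^ n)⁻¹ * b := by positivity
  have hmp : 0 < (γ ^ n)⁻¹ * (γ ^ m)⁻¹ := by positivity
  have hn_iter : ∀ v, 0 ≤ v → v < (γ ^ (n + m))⁻¹ →
      (betaStep γ)^[n] (a + (γ ^ n)⁻¹ * b + v) = b + γ ^ n * v := by
    intro v hv hv'
    rw [add_assoc, ha.iterate n le_rfl _ (by positivity) (by rw [hinv] at hv'; linarith),
      ha.iterate_left]
    field_simp
    ring
  have hvm : ∀ v, v < (γ ^ (n + m))⁻¹ → γ ^ n * v < (γ ^ m)⁻¹ := by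
    intro v hv'
    rw [hinv] at hv'
    rwa [← lt_inv_mul_iff₀ hn]
  have hpos : 0 < (γ ^ (n + m))⁻¹ := by positivity
  refine ⟨by have := ha.nonneg; positivity, ?_, ?_, ?_⟩
  · rw [hinv]; linarith [ha.add_le]
  · intro j hj v hv hv'
    rcases le_total j n with hjn | hjn
    · rw [add_assoc, ha.iterate j hjn _ (by positivity) (by rw [hinv] at hv'; linarith),
        ha.iterate j hjn _ (by positivity) (by linarith)]
      ring
    · obtain ⟨i, rfl⟩ := Nat.exists_eq_add_of_le' hjn
      have h0 := hn_iter 0 le_rfl hpos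
      simp only [add_zero, mul_zero] at h0
      rw [Function.iterate_add_apply, Function.iterate_add_apply, hn_iter v hv hv', h0,
        hb.iterate i (by omega) _ (by positivity) (hvm v hv')]
      ring
  · have h0 := hn_iter 0 le_rfl hpos
    simp only [add_zero, mul_zero] at h0
    rw [add_comm n m, Function.iterate_add_apply, h0, hb.iterate_left]

theorem zero (hγ : 1 < γ) (n : ℕ) : IsFullCylinder γ n 0 := by
  induction n with
  | zero => exact zero_rank
  | succ n ih =>
    have h1 : IsFullCylinder γ 1 0 := by
      refine ⟨le_rfl, ?_, ?_, by simp [betaStep]⟩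
      · simpa using inv_le_one_of_one_le₀ hγ.le
      · intro j hj v hv hv'
        rcases Nat.le_one_iff_eq_zero_or_eq_one.1 hj with rfl | rfl
        · simp
        · have := betaStep_natCast_div_add hγ 0 hv (by
            rwa [pow_one, ← one_div, lt_div_iff₀' (by linarith)] at hv')
          simpa [betaStep] using this
    simpa using ih.append hγ h1

theorem mono (hγ : 1 < γ) (ha : IsFullCylinder γ n a) (h : n ≤ m) : IsFullCylinder γ m a := by
  obtain ⟨k, rfl⟩ := Nat.exists_eq_add_of_le h
  simpa using ha.append hγ (zero hγ k)

/-- Full cylinders of the same rank are disjoint. -/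
theorem add_inv_le (hγ : 1 < γ) (ha : IsFullCylinder γ n a) (hb : IsFullCylinder γ n b)
    (hab : a < b) : a + (γ ^ n)⁻¹ ≤ b := by
  by_contra! h
  have h1 := ha.iterate n le_rfl (b - a) (by linarith) (by linarith)
  rw [add_sub_cancel, ha.iterate_left, hb.iterate_left] at h1
  have : 0 < γ ^ n * (b - a) := mul_pos (by positivity) (by linarith)
  linarith

end IsFullCylinder

theorem finite_setOf_isFullCylinder {γ : ℝ} (hγ : 1 < γ) (n : ℕ) :
    {a | IsFullCylinder γ n a}.Finite := by
  have hn : 0 < γ ^ n := by positivity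
  refine Set.Finite.of_injOn (f := fun a => ⌊γ ^ n * a⌋₊) (t := Set.Iic ⌊γ ^ n⌋₊) ?_ ?_
    (Set.finite_Iic _)
  · intro a ha
    have := ha.add_le
    have : 0 < (γ ^ n)⁻¹ := by positivity
    exact Nat.floor_mono (mul_le_of_le_one_right hn.le (by linarith))
  · have key : ∀ a b, IsFullCylinder γ n a → IsFullCylinder γ n b → a < b →
        ⌊γ ^ n * a⌋₊ ≠ ⌊γ ^ n * b⌋₊ := by
      intro a b ha hb hab h
      have h1 := mul_le_mul_of_nonneg_left (ha.add_inv_le hγ hb hab) hn.le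
      rw [mul_add, mul_inv_cancel₀ hn.ne'] at h1
      have h2 := Nat.floor_mono h1
      rw [Nat.floor_add_one (mul_nonneg hn.le ha.nonneg)] at h2
      omega
    intro a ha b hb h
    rcases lt_trichotomy a b with hlt | heq | hlt
    · exact absurd h (key a b ha hb hlt)
    · exact heq
    · exact absurd h.symm (key b a hb ha hlt)

/-- The points lying in no full cylinder of rank `1, …, m` form a short interval ending at `1`. -/
theorem exists_remainder_interval {γ : ℝ} (hγ : 1 < γ) (m : ℕ) :
    ∃ c, 0 ≤ c ∧ c ≤ 1 ∧ γ ^ m * (1 - c) ≤ 1 ∧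
      (∀ j ≤ m, ∀ v, 0 ≤ v → c + v < 1 →
        (betaStep γ)^[j] (c + v) = (betaStep γ)^[j] c + γ ^ j * v) ∧
      (c < 1 → (betaStep γ)^[m] c = 0) ∧
      ∀ u, 0 ≤ u → u < 1 → c ≤ u ∨
        ∃ j, 1 ≤ j ∧ j ≤ m ∧ ∃ a, IsFullCylinder γ j a ∧ a ≤ u ∧ u < a + (γ ^ j)⁻¹ := by
  induction m with
  | zero =>
    refine ⟨0, le_rfl, zero_le_one, by simp, ?_, fun _ => rfl, fun u hu _ => Or.inl hu⟩
    intro j hj v _ _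
    simp [Nat.le_zero.1 hj]
  | succ m ih =>
    obtain ⟨c, hc0, hc1, hct, hiter, hleft, hcov⟩ := ih
    have hγ0 : 0 < γ := by linarith
    have hm : 0 < γ ^ m := by positivity
    have hm1 : 0 < γ ^ (m + 1) := by positivity
    -- subdividing the remainder interval of rank `m`
    have hsub : ∀ i : ℕ, ∀ v, 0 ≤ v → γ ^ (m + 1) * v < 1 → c + i / γ ^ (m + 1) + v < 1 →
        (∀ j ≤ m + 1, (betaStep γ)^[j] (c + i / γ ^ (m + 1) + v) =
          (betaStep γ)^[j] (c + i / γ ^ (m + 1)) + γ ^ j * v) ∧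
        (betaStep γ)^[m + 1] (c + i / γ ^ (m + 1)) = 0 := by
      intro i v hv hv1 hlt
      have hi0 : 0 ≤ (i : ℝ) / γ ^ (m + 1) := by positivity
      have hstep : ∀ v, 0 ≤ v → γ ^ (m + 1) * v < 1 → c + i / γ ^ (m + 1) + v < 1 →
          (betaStep γ)^[m + 1] (c + i / γ ^ (m + 1) + v) = γ ^ (m + 1) * v := by
        intro v hv hv1 hlt
        rw [Function.iterate_succ_apply', add_assoc,
          hiter m le_rfl _ (by positivity) (by linarith), hleft (by linarith)]
        have : 0 + γ ^ m * (i / γ ^ (m + 1) + v) = i / γ + γ ^ m * v := by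
          field_simp; ring
        rw [this, betaStep_natCast_div_add hγ i (by positivity)
          (by rwa [← mul_assoc, ← pow_succ'])]
        ring
      have h0 := hstep 0 le_rfl (by simp) (by linarith)
      simp only [add_zero, mul_zero] at h0
      refine ⟨fun j hj => ?_, h0⟩
      rcases Nat.le_succ_iff.1 hj with hj | rfl
      · rw [add_assoc, hiter j hj _ (by positivity) (by linarith),
          hiter j hj _ hi0 (by linarith)]
        ring
      · rw [hstep v hv hv1 hlt, h0, zero_add]
    have hw0 : 0 ≤ γ ^ (m + 1) * (1 - c) := mul_nonneg hm1.le (by linarith)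
    set q := ⌊γ ^ (m + 1) * (1 - c)⌋₊ with hq
    have hq1 : (q : ℝ) ≤ γ ^ (m + 1) * (1 - c) := Nat.floor_le hw0
    have hq2 : γ ^ (m + 1) * (1 - c) < q + 1 := Nat.lt_floor_add_one _
    have hcanc : γ ^ (m + 1) * (q / γ ^ (m + 1)) = q := by field_simp
    refine ⟨c + q / γ ^ (m + 1), by positivity, ?_, ?_, ?_, ?_, ?_⟩
    · have : (q : ℝ) / γ ^ (m + 1) ≤ 1 - c := by rw [div_le_iff₀' hm1]; exact hq1
      linarith
    · nlinarith
    · intro j hj v hv hlt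
      refine (hsub q v hv ?_ hlt).1 j hj
      nlinarith [mul_lt_mul_of_pos_left hlt hm1]
    · intro hlt
      exact (hsub q 0 le_rfl (by simp) (by simpa using hlt)).2
    · intro u hu hu1
      rcases hcov u hu hu1 with hcu | ⟨j, hj1, hj2, h⟩
      swap
      · exact Or.inr ⟨j, hj1, by omega, h⟩
      rcases le_or_gt (c + q / γ ^ (m + 1)) u with h | h
      · exact Or.inl h
      refine Or.inr ⟨m + 1, by omega, le_rfl, ?_⟩
      have hv0 : 0 ≤ γ ^ (m + 1) * (u - c) := mul_nonneg hm1.le (by linarith)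
      set i := ⌊γ ^ (m + 1) * (u - c)⌋₊ with hi
      have hi1 : (i : ℝ) ≤ γ ^ (m + 1) * (u - c) := Nat.floor_le hv0
      have hi2 : γ ^ (m + 1) * (u - c) < i + 1 := Nat.lt_floor_add_one _
      have hiq : i + 1 ≤ q := by
        have : (i : ℝ) < q := by
          refine hi1.trans_lt ?_
          rw [← hcanc]
          exact mul_lt_mul_of_pos_left (by linarith) hm1
        exact_mod_cast this
      have hend : c + i / γ ^ (m + 1) + (γ ^ (m + 1))⁻¹ ≤ 1 := by
        have : (i : ℝ) / γ ^ (m + 1) + (γ ^ (m + 1))⁻¹ = ((i + 1 : ℕ) : ℝ) / γ ^ (m + 1) := by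
          push_cast; field_simp
        rw [add_assoc, this]
        have : ((i + 1 : ℕ) : ℝ) / γ ^ (m + 1) ≤ 1 - c := by
          rw [div_le_iff₀' hm1]
          exact le_trans (by exact_mod_cast hiq) hq1
        linarith
      have hpos : 0 < (γ ^ (m + 1))⁻¹ := by positivity
      refine ⟨c + i / γ ^ (m + 1), ⟨by positivity, hend, ?_, ?_⟩, ?_, ?_⟩
      · intro j hj v hv hv'
        refine (hsub i v hv ?_ (by linarith)).1 j hj
        have := mul_lt_mul_of_pos_left hv' hm1
        rwa [mul_inv_cancel₀ hm1.ne'] at this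
      · exact (hsub i 0 le_rfl (by simp) (by linarith)).2
      · have : (i : ℝ) / γ ^ (m + 1) ≤ u - c := by rwa [div_le_iff₀' hm1]
        linarith
      · have : u - c < (i + 1) / γ ^ (m + 1) := by rwa [lt_div_iff₀' hm1]
        rw [add_div, one_div] at this
        linarith

/-- There are at least `γ ^ n / (n + 1)` full cylinders of rank `n`. -/
theorem pow_le_card_isFullCylinder {γ : ℝ} (hγ : 1 < γ) (n : ℕ) {A : Finset ℝ}
    (hA : ∀ a, IsFullCylinder γ n a → a ∈ A) : γ ^ n ≤ (n + 1) * A.card := by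
  choose c hc0 hc1 hct _ _ hcov using exists_remainder_interval hγ
  have hcover : Set.Ico (0 : ℝ) 1 ⊆ ⋃ p ∈ Finset.range (n + 1) ×ˢ A,
      Set.Ico (p.2 + (γ ^ p.1)⁻¹ * c (n - p.1)) (p.2 + (γ ^ p.1)⁻¹) := by
    rintro u ⟨hu0, hu1⟩
    classical
    let P : ℕ → Prop := fun k => ∃ a, IsFullCylinder γ k a ∧ a ≤ u ∧ u < a + (γ ^ k)⁻¹
    have hP0 : P 0 := ⟨0, IsFullCylinder.zero_rank, hu0, by simpa using hu1⟩
    obtain ⟨a, ha, hau, hua⟩ := Nat.findGreatest_spec (Nat.zero_le n) hP0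
    have hkn : Nat.findGreatest P n ≤ n := Nat.findGreatest_le n
    have hmax : ∀ j, Nat.findGreatest P n < j → j ≤ n → ¬ P j :=
      fun j => Nat.findGreatest_is_greatest
    generalize Nat.findGreatest P n = k at *
    have hk : 0 < γ ^ k := by positivity
    have hscale : (γ ^ k)⁻¹ * (γ ^ k * (u - a)) = u - a := by field_simp
    simp only [Set.mem_iUnion, Finset.mem_product, Finset.mem_range]
    refine ⟨(k, a), ⟨by omega, hA a (ha.mono hγ hkn)⟩, ?_, hua⟩
    rcases hcov (n - k) (γ ^ k * (u - a)) (mul_nonneg hk.le (by linarith)) (by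
      have := mul_lt_mul_of_pos_left (show u - a < (γ ^ k)⁻¹ by linarith) hk
      rwa [mul_inv_cancel₀ hk.ne'] at this) with h | ⟨j, hj1, hj2, b, hb, hbu, hub⟩
    · have := mul_le_mul_of_nonneg_left h (show 0 ≤ (γ ^ k)⁻¹ by positivity)
      rw [hscale] at this
      show a + (γ ^ k)⁻¹ * c (n - k) ≤ u
      linarith
    · refine absurd ?_ (hmax (k + j) (by omega) (by omega))
      refine ⟨_, ha.append hγ hb, ?_, ?_⟩
      · have := mul_le_mul_of_nonneg_left hbu (show 0 ≤ (γ ^ k)⁻¹ by positivity)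
        linarith
      · have := mul_lt_mul_of_pos_left hub (show 0 < (γ ^ k)⁻¹ by positivity)
        rw [hscale, mul_add, ← mul_inv, ← pow_add] at this
        linarith
  have hvol := (MeasureTheory.measure_mono (μ := MeasureTheory.volume) hcover).trans
    (MeasureTheory.measure_biUnion_finset_le _ _)
  have hterm : ∀ p ∈ Finset.range (n + 1) ×ˢ A, MeasureTheory.volume
      (Set.Ico (p.2 + (γ ^ p.1)⁻¹ * c (n - p.1)) (p.2 + (γ ^ p.1)⁻¹)) ≤
      ENNReal.ofReal (γ ^ n)⁻¹ := by
    rintro ⟨k, a⟩ hp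
    simp only [Finset.mem_product, Finset.mem_range] at hp
    rw [Real.volume_Ico]
    refine ENNReal.ofReal_le_ofReal ?_
    have h2 : γ ^ n = γ ^ k * γ ^ (n - k) := by rw [← pow_add]; congr 1; omega
    have h3 : 1 - c (n - k) ≤ (γ ^ (n - k))⁻¹ := by
      rw [← one_div, le_div_iff₀' (by positivity)]; exact hct _
    have h4 := mul_le_mul_of_nonneg_left h3 (show 0 ≤ (γ ^ k)⁻¹ by positivity)
    rw [h2, mul_inv]
    simp only
    linarith
  have hsum := hvol.trans (Finset.sum_le_card_nsmul _ _ _ hterm)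
  rw [Real.volume_Ico, nsmul_eq_mul, Finset.card_product, Finset.card_range, sub_zero,
    ← ENNReal.ofReal_natCast, ← ENNReal.ofReal_mul (by positivity),
    ENNReal.ofReal_le_ofReal_iff (by positivity), ← div_eq_mul_inv, le_div_iff₀ (by positivity),
    one_mul] at hsum
  exact_mod_cast hsum

/-- An `r`-separated finite set has at most two points in an open interval of length `2 * r`. -/
theorem card_le_two_of_separated {r u : ℝ} {S : Finset ℝ}
    (hsep : ∀ a ∈ S, ∀ b ∈ S, a < b → a + r ≤ b) (hu : ∀ a ∈ S, u < a)
    (hu' : ∀ a ∈ S, a < u + 2 * r) : S.card ≤ 2 := by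
  by_contra! h
  obtain ⟨a, b, c, ha, hb, hc, hab, hac, hbc⟩ := Finset.two_lt_card_iff.1 h
  have hsep' : ∀ a ∈ S, ∀ b ∈ S, a ≠ b → a + r ≤ b ∨ b + r ≤ a := fun a ha b hb hab =>
    hab.lt_or_gt.imp (hsep a ha b hb) (hsep b hb a ha)
  have := hu a ha; have := hu b hb; have := hu c hc
  have := hu' a ha; have := hu' b hb; have := hu' c hc
  rcases hsep' a ha b hb hab with _ | _ <;> rcases hsep' a ha c hc hac with _ | _ <;>
    rcases hsep' b hb c hc hbc with _ | _ <;> linarith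

/-- After a full cylinder `w`, all but `2 * L + 1` of the full cylinders of rank `L` keep the first
`L` iterates away from `y`, and do not come close to `1`. -/
theorem card_le_card_good_add {γ : ℝ} (hγ : 1 < γ) {L : ℕ} {r : ℝ} (hr : r = (γ ^ L)⁻¹) (y : ℝ)
    {A : Finset ℝ} (hA : ∀ a ∈ A, IsFullCylinder γ L a) {w : ℝ} (hw : IsFullCylinder γ L w)
    {G : Finset ℝ} (hG : ∀ b ∈ A, b ≤ 1 - 2 * r → (∀ j < L, ∀ v, 0 ≤ v → v < 1 →
      r ^ 2 / 2 ≤ |(betaStep γ)^[j] (w + r * (b + r * v)) - y|) → b ∈ G) :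
    A.card ≤ G.card + (2 * L + 1) := by
  classical
  have hr0 : 0 < r := by rw [hr]; positivity
  have hsep : ∀ a ∈ A, ∀ b ∈ A, a < b → a + r ≤ b := fun a ha b hb hab => by
    rw [hr]; exact (hA a ha).add_inv_le hγ (hA b hb) hab
  let top := A.filter fun b => 1 - 2 * r < b
  let bad : ℕ → Finset ℝ := fun j => A.filter fun b => ∃ v, 0 ≤ v ∧ v < 1 ∧
    |(betaStep γ)^[j] (w + r * (b + r * v)) - y| < r ^ 2 / 2
  have hcover : A ⊆ G ∪ (top ∪ (Finset.range L).biUnion bad) := by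
    intro b hb
    by_contra h
    simp only [Finset.mem_union, Finset.mem_biUnion, Finset.mem_range, Finset.mem_filter, not_or,
      not_exists, not_and, top, bad] at h
    obtain ⟨h1, h2, h3⟩ := h
    exact h1 (hG b hb (not_lt.1 (h2 hb)) fun j hj v hv hv' => not_lt.1 (h3 j hj hb v hv hv'))
  have htop : top.card ≤ 1 := by
    rw [Finset.card_le_one]
    have key : ∀ a ∈ top, ∀ b ∈ top, ¬ a < b := by
      intro a ha b hb hab
      rw [Finset.mem_filter] at ha hb
      have h1 := hsep a ha.1 b hb.1 hab
      have h2 := (hA b hb.1).add_le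
      rw [← hr] at h2
      linarith [ha.2]
    intro a ha b hb
    exact le_antisymm (not_lt.1 (key b hb a ha)) (not_lt.1 (key a ha b hb))
  have hbad : ∀ j ∈ Finset.range L, (bad j).card ≤ 2 := by
    intro j hj
    have hj' : j ≤ L := (Finset.mem_range.1 hj).le
    have hgj : 1 ≤ γ ^ j := one_le_pow₀ hγ.le
    set z := (y - (betaStep γ)^[j] w) / (γ ^ j * r) with hz
    have key : ∀ b ∈ bad j, z - 3 / 2 * r < b ∧ b < z + r / 2 := by
      intro b hb
      obtain ⟨hbA, v, hv0, hv1, hv⟩ := Finset.mem_filter.1 hb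
      have hb0 := (hA b hbA).nonneg
      have hb1 := (hA b hbA).add_le
      rw [← hr] at hb1
      have hrv : r * v < r := by nlinarith
      have hrv0 : 0 ≤ r * v := by positivity
      rw [hw.iterate j hj' _ (by positivity) (by rw [← hr]; nlinarith)] at hv
      have hden : 0 < γ ^ j * r := by positivity
      have hy : (betaStep γ)^[j] w - y = - (γ ^ j * r * z) := by
        rw [hz, mul_div_cancel₀ _ hden.ne']; ring
      have hfac : (betaStep γ)^[j] w + γ ^ j * (r * (b + r * v)) - y =
          γ ^ j * r * (b + r * v - z) := by linear_combination hy
      rw [hfac, abs_mul, abs_of_pos hden] at hv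
      have : r * |b + r * v - z| < r * (r / 2) := by
        have h1 : r * |b + r * v - z| ≤ γ ^ j * (r * |b + r * v - z|) :=
          le_mul_of_one_le_left (by positivity) hgj
        nlinarith
      have := lt_of_mul_lt_mul_left this hr0.le
      rw [abs_lt] at this
      constructor <;> linarith [this.1, this.2]
    refine card_le_two_of_separated (r := r) (u := z - 3 / 2 * r) ?_ (fun b hb => (key b hb).1)
      (fun b hb => by linarith [(key b hb).2])
    exact fun a ha b hb => hsep a (Finset.mem_filter.1 ha).1 b (Finset.mem_filter.1 hb).1
  have h1 := Finset.card_le_card hcover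
  have h2 := Finset.card_union_le G (top ∪ (Finset.range L).biUnion bad)
  have h3 := Finset.card_union_le top ((Finset.range L).biUnion bad)
  have h4 := Finset.card_biUnion_le_card_mul _ _ _ hbad
  rw [Finset.card_range] at h4
  omega

/-- The sequence of states visited from `a` when reading the letters `ω`. -/
def stateSeq {S : Type*} {M : ℕ} (σ : S → Fin M → S) (a : S) (ω : ℕ → Fin M) : ℕ → S
  | 0 => a
  | k + 1 => σ (stateSeq σ a ω k) (ω k)

theorem stateSeq_congr {S : Type*} {M : ℕ} (σ : S → Fin M → S) (a : S) {ω ω' : ℕ → Fin M} {k : ℕ}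
    (h : ∀ i < k, ω i = ω' i) : stateSeq σ a ω k = stateSeq σ a ω' k := by
  induction k with
  | zero => rfl
  | succ k ih => rw [stateSeq, stateSeq, ih fun i hi => h i (by omega), h k (by omega)]

/-- Iterating past the first full cylinders shifts the digit series. -/
theorem iterate_digitSeries {γ : ℝ} (hγ : 1 < γ) {L : ℕ} (hL : L ≠ 0) {r : ℝ}
    (hr : r = (γ ^ L)⁻¹) (k : ℕ) :
    ∀ {a : ℕ → ℝ}, (∀ i, IsFullCylinder γ L (a i)) → (∀ i, a i ≤ 1 - 2 * r) →
    (betaStep γ)^[k * L] (digitSeries r a) = digitSeries r fun i => a (i + k) := by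
  have hr0 : 0 < r := by rw [hr]; positivity
  have hr1 : r < 1 := by rw [hr]; exact inv_lt_one_of_one_lt₀ (one_lt_pow₀ hγ hL)
  induction k with
  | zero => intro a _ _; simp
  | succ k ih =>
    intro a ha ha'
    have h0 := digitSeries_nonneg hr0 fun i => (ha (i + 1)).nonneg
    have h1 := digitSeries_le hr0 hr1 (fun i => (ha (i + 1)).nonneg) fun i => ha' (i + 1)
    rw [add_one_mul, Function.iterate_add_apply, digitSeries_succ hr0 hr1
      (fun i => (ha i).nonneg) ha', (ha 0).iterate L le_rfl _ (by positivity)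
      (by rw [← hr]; nlinarith), (ha 0).iterate_left, zero_add, ← mul_assoc]
    have : γ ^ L * r = 1 := by rw [hr]; exact mul_inv_cancel₀ (by positivity)
    rw [this, one_mul, ih (fun i => ha (i + 1)) fun i => ha' (i + 1)]
    simp only [add_assoc]

/-- If there are enough full cylinders of rank `L`, the points whose orbits stay away from `y` have
dimension at least `s`. -/
theorem le_dimH_of_card {γ : ℝ} (hγ : 1 < γ) {L M : ℕ} (hL : L ≠ 0) (hM : 1 < M)
    {s : NNReal} (hs : 0 < s) (hMs : (γ ^ L) ^ (s : ℝ) ≤ M) {A : Finset ℝ}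
    (hA : ∀ a ∈ A, IsFullCylinder γ L a) (hcard : M + (2 * L + 1) ≤ A.card) (y : ℝ) :
    (s : ENNReal) ≤ dimH {x : ℝ | 0 ≤ x ∧ x ≤ 1 ∧
      ∃ ε > 0, ∀ n, ε ≤ |(betaStep γ)^[n] x - y|} := by
  classical
  obtain ⟨r, hr⟩ : ∃ r, r = (γ ^ L)⁻¹ := ⟨_, rfl⟩
  have hr0 : 0 < r := by rw [hr]; positivity
  have hr1 : r < 1 := by rw [hr]; exact inv_lt_one_of_one_lt₀ (one_lt_pow₀ hγ hL)
  let S := {a : ℝ // a ∈ A ∧ a ≤ 1 - 2 * r}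
  let good : ℝ → Finset ℝ := fun w => A.filter fun b => b ≤ 1 - 2 * r ∧ ∀ j < L, ∀ v, 0 ≤ v →
    v < 1 → r ^ 2 / 2 ≤ |(betaStep γ)^[j] (w + r * (b + r * v)) - y|
  have hgood : ∀ w ∈ A, M ≤ (good w).card := by
    intro w hw
    have := card_le_card_good_add hγ hr y hA (hA w hw) (G := good w)
      fun b hb h1 h2 => Finset.mem_filter.2 ⟨hb, h1, h2⟩
    omega
  have hemb : ∀ w : S, Nonempty (Fin M ↪ good w.1) := fun w =>
    Function.Embedding.nonempty_of_card_le (by simpa using hgood w.1 w.2.1)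
  let e : ∀ w : S, Fin M ↪ good w.1 := fun w => (hemb w).some
  have he : ∀ w i, (e w i : ℝ) ∈ A ∧ (e w i : ℝ) ≤ 1 - 2 * r ∧ ∀ j < L, ∀ v, 0 ≤ v →
      v < 1 → r ^ 2 / 2 ≤ |(betaStep γ)^[j] (w.1 + r * (e w i + r * v)) - y| :=
    fun w i => Finset.mem_filter.1 (e w i).2
  let σ : S → Fin M → S := fun w i => ⟨e w i, (he w i).1, (he w i).2.1⟩
  obtain ⟨a₀, ha₀⟩ : ∃ a, a ∈ A := Finset.card_pos.1 (by omega)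
  obtain ⟨b₀, hb₀⟩ : ∃ b, b ∈ good a₀ := Finset.card_pos.1 (by have := hgood a₀ ha₀; omega)
  let start : S := ⟨b₀, (Finset.mem_filter.1 hb₀).1, (Finset.mem_filter.1 hb₀).2.1⟩
  let digit : (ℕ → Fin M) → ℕ → ℝ := fun ω k => (stateSeq σ start ω k).1
  have hfull : ∀ ω k, IsFullCylinder γ L (digit ω k) := fun ω k => hA _ (stateSeq σ start ω k).2.1
  have hnn : ∀ ω k, 0 ≤ digit ω k := fun ω k => (hfull ω k).nonneg
  have htop : ∀ ω k, digit ω k ≤ 1 - 2 * r := fun ω k => (stateSeq σ start ω k).2.2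
  have hsepA : ∀ a ∈ A, ∀ b ∈ A, a ≠ b → r ≤ |a - b| := by
    intro a ha b hb hab
    rcases hab.lt_or_gt with h | h
    · have := (hA a ha).add_inv_le hγ (hA b hb) h
      rw [← hr] at this
      exact le_abs'.2 (Or.inl (by linarith))
    · have := (hA b hb).add_inv_le hγ (hA a ha) h
      rw [← hr] at this
      exact le_abs'.2 (Or.inr (by linarith))
  have hdim : (s : ENNReal) ≤ dimH (Set.range fun ω => digitSeries r (digit ω)) := by
    refine le_dimH_range_of_separated hM _ hr0 (c := r ^ 3) (by positivity) hs ?_ ?_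
    · rw [hr, Real.inv_rpow (by positivity), ← div_eq_mul_inv, one_le_div (by positivity)]
      exact hMs
    · intro ω ω' k hk hne
      have hst := stateSeq_congr σ start hk
      have hle := le_dist_digitSeries hr0 hr1 (k + 1) (hnn ω) (htop ω) (hnn ω') (htop ω')
        (fun i hi => congrArg Subtype.val (stateSeq_congr σ start fun l hl => hk l (by omega)))
        (hsepA _ (stateSeq σ start ω (k + 1)).2.1 _ (stateSeq σ start ω' (k + 1)).2.1 (by
          show ((e _ _ : good _) : ℝ) ≠ (e _ _ : good _)
          rw [hst]
          exact fun h => hne ((e _).injective (Subtype.ext h))))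
      calc r ^ 3 * r ^ k = r ^ 2 * r ^ (k + 1) := by ring
        _ ≤ _ := hle
  refine hdim.trans (dimH_mono ?_)
  rintro _ ⟨ω, rfl⟩
  refine ⟨digitSeries_nonneg hr0 (hnn ω),
    (digitSeries_le hr0 hr1 (hnn ω) (htop ω)).trans (by linarith), r ^ 2 / 2, by positivity, ?_⟩
  intro n
  have hn : n = n % L + n / L * L := (Nat.mod_add_div' n L).symm
  have hj : n % L < L := Nat.mod_lt _ (Nat.pos_of_ne_zero hL)
  generalize n % L = j at hn hj
  generalize n / L = k at hn
  rw [hn, Function.iterate_add_apply, iterate_digitSeries hγ hL hr k (hfull ω) (htop ω),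
    digitSeries_succ hr0 hr1 (fun i => hnn ω _) (fun i => htop ω _),
    digitSeries_succ hr0 hr1 (fun i => hnn ω _) (fun i => htop ω _)]
  have h0 := digitSeries_nonneg hr0 fun i => hnn ω (i + 1 + 1 + k)
  have h1 := digitSeries_le hr0 hr1 (fun i => hnn ω (i + 1 + 1 + k)) fun i => htop ω _
  have hmain := (he (stateSeq σ start ω k) (ω k)).2.2 j hj _ h0 (by linarith)
  simp only [zero_add, add_comm 1 k]
  exact hmain

/-- Exponential growth of rate `γ` beats growth of rate `γ ^ s`, up to polynomial factors. -/
theorem exists_rank {γ s : ℝ} (hγ : 1 < γ) (hs1 : s < 1) :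
    ∃ L : ℕ, L ≠ 0 ∧ ((L : ℝ) + 1) * ((γ ^ L) ^ s + 1 + (2 * L + 1)) ≤ γ ^ L := by
  have hγ0 : 0 < γ := by linarith
  have hq : |γ ^ (s - 1)| < 1 := by
    rw [abs_of_pos (by positivity)]
    exact Real.rpow_lt_one_of_one_lt_of_neg hγ (by linarith)
  have hp : |γ⁻¹| < 1 := by
    rw [abs_of_pos (by positivity)]
    exact inv_lt_one_of_one_lt₀ hγ
  have t1 := tendsto_pow_const_mul_const_pow_of_abs_lt_one 1 hq
  have t2 := tendsto_pow_const_mul_const_pow_of_abs_lt_one 0 hq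
  have t3 := tendsto_pow_const_mul_const_pow_of_abs_lt_one 2 hp
  have t4 := tendsto_pow_const_mul_const_pow_of_abs_lt_one 1 hp
  have t5 := tendsto_pow_const_mul_const_pow_of_abs_lt_one 0 hp
  have t := ((t1.add t2).add ((t3.const_mul 2).add ((t4.const_mul 4).add (t5.const_mul 2))))
  simp only [mul_zero, add_zero] at t
  obtain ⟨L, hlt, hL⟩ := ((t.eventually_lt_const one_pos).and
    (Filter.eventually_ne_atTop 0)).exists
  refine ⟨L, hL, ?_⟩
  have hpos : 0 < γ ^ L := by positivity
  have e1 : (γ ^ (s - 1)) ^ L = (γ ^ L) ^ s * (γ ^ L)⁻¹ := by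
    rw [← Real.rpow_natCast, ← Real.rpow_mul hγ0.le, ← Real.rpow_natCast, ← Real.rpow_mul hγ0.le,
      ← Real.rpow_neg hγ0.le, ← Real.rpow_add hγ0]
    congr 1; ring
  rw [e1, inv_pow] at hlt
  have := mul_lt_mul_of_pos_right hlt hpos
  have e2 : (γ ^ L)⁻¹ * γ ^ L = 1 := inv_mul_cancel₀ hpos.ne'
  refine le_of_lt (lt_of_eq_of_lt ?_ (this.trans_eq (one_mul _)))
  linear_combination (-(((L : ℝ) + 1) * ((γ ^ L) ^ s + 1 + (2 * L + 1)))) * e2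

theorem le_dimH_betaStep {γ : ℝ} (hγ : 1 < γ) {s : NNReal} (hs : 0 < s) (hs1 : s < 1) (y : ℝ) :
    (s : ENNReal) ≤ dimH {x : ℝ | 0 ≤ x ∧ x ≤ 1 ∧
      ∃ ε > 0, ∀ n, ε ≤ |(betaStep γ)^[n] x - y|} := by
  obtain ⟨L, hL, hrank⟩ := exists_rank hγ (s := s) (by exact_mod_cast hs1)
  let A := (finite_setOf_isFullCylinder hγ L).toFinset
  have hA : ∀ a, a ∈ A ↔ IsFullCylinder γ L a := fun a => by simp [A]
  have hcard := pow_le_card_isFullCylinder hγ L (A := A) fun a => (hA a).2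
  have hle := hrank.trans hcard
  have hle := le_of_mul_le_mul_left hle (by positivity)
  have hpow : 1 < (γ ^ L) ^ (s : ℝ) := Real.one_lt_rpow (one_lt_pow₀ hγ hL) (by exact_mod_cast hs)
  refine le_dimH_of_card hγ hL (M := ⌈(γ ^ L) ^ (s : ℝ)⌉₊) ?_ hs (Nat.le_ceil _)
    (fun a => (hA a).1) ?_ y
  · exact Nat.lt_ceil.2 (by exact_mod_cast hpow)
  · have h := Nat.ceil_lt_add_one (show 0 ≤ (γ ^ L) ^ (s : ℝ) by positivity)
    have : ((⌈(γ ^ L) ^ (s : ℝ)⌉₊ + (2 * L + 1) : ℕ) : ℝ) ≤ A.card := by push_cast; linarith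
    exact_mod_cast this

/-- For the map `T x = γ x mod 1` on `[0,1]` with real `γ > 1`
and any target `y ∈ [0,1]`, the set `{x ∈ [0,1] : liminf_n |T^n x - y| > 0}` has
Hausdorff dimension `1`. -/
theorem betaMap_nonshrinking_target_full_dimH
    (γ : ℝ) (hγ : 1 < γ)
    (T : Set.Icc (0:ℝ) 1 → Set.Icc (0:ℝ) 1)
    (hT : ∀ x : Set.Icc (0:ℝ) 1, ((T x : ℝ)) = Int.fract (γ * (x : ℝ)))
    (y : Set.Icc (0:ℝ) 1) :
    dimH {x : Set.Icc (0:ℝ) 1 |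
      0 < Filter.liminf (fun n => |((T^[n] x : ℝ)) - (y : ℝ)|) Filter.atTop} = 1 := by
  rw [← (isometry_subtype_coe (s := Set.Icc (0 : ℝ) 1)).dimH_image]
  refine le_antisymm ((dimH_mono (Set.subset_univ _)).trans_eq Real.dimH_univ) ?_
  refine ENNReal.le_of_forall_nnreal_lt fun s hs => ?_
  rcases eq_or_ne s 0 with rfl | hs0
  · simp
  refine (le_dimH_betaStep hγ (pos_iff_ne_zero.2 hs0) (by exact_mod_cast hs) y).trans
    (dimH_mono ?_)
  rintro x ⟨hx0, hx1, ε, hε, hx⟩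
  have hconj : ∀ n (z : Set.Icc (0 : ℝ) 1), ((T^[n] z : Set.Icc (0 : ℝ) 1) : ℝ) =
      (betaStep γ)^[n] z := fun n z =>
    Function.Semiconj.iterate_right (f := Subtype.val) (ga := T) (gb := betaStep γ) hT n z
  refine ⟨⟨x, hx0, hx1⟩, hε.trans_le (Filter.le_liminf_of_le ?_ ?_), rfl⟩
  · refine Filter.IsBoundedUnder.isCoboundedUnder_ge ⟨1, ?_⟩
    refine Filter.eventually_map.2 (Filter.Eventually.of_forall fun n => ?_)
    exact abs_sub_le_of_le_of_le (T^[n] ⟨x, hx0, hx1⟩).2.1 (T^[n] ⟨x, hx0, hx1⟩).2.2 y.2.1 y.2.2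
      |>.trans_eq (sub_zero 1)
  · exact Filter.Eventually.of_forall fun n => by rw [hconj]; exact hx n
end

section
/- Let T : [0,1] → [0,1] be the Gauss map, T(0) = 0 and T(x) = 1/x mod 1 (the fractional part of 1/x) for x ≠ 0. Then the set {x ∈ [0,1] : liminf_{n→∞} |T^n x| > 0} has Hausdorff dimension 1. -/
/-- `x` is badly approximable with constant `c`: every rational `p / q` is at distance at least
`c / q ^ 2` from `x`. -/
def IsBadlyApproximableWith (c x : ℝ) : Prop :=
  ∀ p q : ℤ, 1 ≤ q → c / (q : ℝ) ^ 2 ≤ |x - p / q|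

/-- Distinct fractions whose denominators `q` satisfy `2 * q ^ 2 * ℓ ≤ 1` are `2 * ℓ` apart. -/
theorem two_mul_le_abs_div_sub_div {ℓ : ℝ} (hℓ : 0 < ℓ) {p q p' q' : ℤ} (hq : 1 ≤ q)
    (hq' : 1 ≤ q') (h : 2 * (q : ℝ) ^ 2 * ℓ ≤ 1) (h' : 2 * (q' : ℝ) ^ 2 * ℓ ≤ 1)
    (hne : (p : ℝ) / q ≠ p' / q') : 2 * ℓ ≤ |(p : ℝ) / q - p' / q'| := by
  have hq0 : (0 : ℝ) < q := by exact_mod_cast hq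
  have hq0' : (0 : ℝ) < q' := by exact_mod_cast hq'
  have hnum : p * q' - q * p' ≠ 0 := by
    intro h0
    apply hne
    rw [div_eq_div_iff hq0.ne' hq0'.ne']
    have : ((p * q' - q * p' : ℤ) : ℝ) = 0 := by rw [h0]; simp
    push_cast at this
    linarith
  have hone : (1 : ℝ) ≤ |(p : ℝ) * q' - q * p'| := by
    exact_mod_cast Int.one_le_abs hnum
  rw [div_sub_div _ _ hq0.ne' hq0'.ne', abs_div, abs_of_pos (mul_pos hq0 hq0'),
    le_div_iff₀ (mul_pos hq0 hq0')]
  nlinarith [mul_nonneg hℓ.le (sq_nonneg ((q : ℝ) - q'))]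

/-- Either the first or the last quarter of `[a, a + ℓ]` stays `ℓ / 4` away from all fractions
with denominators `q` such that `2 * q ^ 2 * ℓ ≤ 1`. -/
theorem exists_quarter_far_from_fractions (a : ℝ) {ℓ : ℝ} (hℓ : 0 < ℓ) :
    ∃ t, 0 ≤ t ∧ t ≤ 3 * ℓ / 4 ∧ ∀ p q : ℤ, 1 ≤ q → 2 * (q : ℝ) ^ 2 * ℓ ≤ 1 →
      ∀ x ∈ Set.Icc (a + t) (a + t + ℓ / 4), ℓ / 4 ≤ |x - p / q| := by
  by_contra! hcon
  obtain ⟨p, q, hq, h, x, ⟨hx₁, hx₂⟩, hx⟩ := hcon 0 le_rfl (by positivity)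
  obtain ⟨p', q', hq', h', x', ⟨hx₁', hx₂'⟩, hx'⟩ := hcon (3 * ℓ / 4) (by positivity) le_rfl
  rw [abs_lt] at hx hx'
  have hlt : (p : ℝ) / q < p' / q' := by linarith
  have := two_mul_le_abs_div_sub_div hℓ hq hq' h h' hlt.ne
  rw [abs_of_neg (by linarith)] at this
  linarith

/-- A Cantor set of badly approximable numbers, coded by the sequences of `N` digits, in which
sequences that differ in the digit `n` give points that are `(8 * N) ^ (-(n + 1)) / 2` apart. -/
theorem exists_badlyApproximable_coding {N : ℕ} (hN : 1 ≤ N) :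
    ∃ X : (ℕ → Fin N) → ℝ,
      (∀ k, X k ∈ Set.Icc (0 : ℝ) 1 ∧ IsBadlyApproximableWith (1 / (64 * N)) (X k)) ∧
      ∀ k k' n, (∀ i < n, k i = k' i) → k n ≠ k' n →
        ((8 * N : ℝ) ^ (n + 1))⁻¹ / 2 ≤ |X k - X k'| := by
  have hN' : (1 : ℝ) ≤ N := by exact_mod_cast hN
  set len : ℕ → ℝ := fun n => ((8 * N : ℝ) ^ n)⁻¹ / 2 with hlen
  have len_pos : ∀ n, 0 < len n := fun n => by positivity
  have len_succ : ∀ n, 8 * N * len (n + 1) = len n := fun n => by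
    simp only [hlen, pow_succ]
    field_simp
  choose t ht₀ ht₁ ht using fun (a : ℝ) (n : ℕ) =>
    exists_quarter_far_from_fractions a (len_pos n)
  let a : (ℕ → Fin N) → ℕ → ℝ := fun k n =>
    Nat.rec 0 (fun n y => y + t y n + 2 * (k n : ℕ) * len (n + 1)) n
  have a_succ : ∀ k n, a k (n + 1) = a k n + t (a k n) n + 2 * (k n : ℕ) * len (n + 1) :=
    fun _ _ => rfl
  have digit_le : ∀ (k : ℕ → Fin N) n, (((k n : ℕ) : ℝ) + 1) ≤ N := fun k n => by
    exact_mod_cast (k n).isLt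
  have step_le : ∀ (k : ℕ → Fin N) n,
      2 * (k n : ℕ) * len (n + 1) + len (n + 1) ≤ len n / 4 := fun k n => by
    nlinarith [len_succ n, len_pos (n + 1), digit_le k n]
  have step_nonneg : ∀ (k : ℕ → Fin N) n, 0 ≤ 2 * (k n : ℕ) * len (n + 1) := fun k n =>
    mul_nonneg (by positivity) (len_pos _).le
  have hmono : ∀ k, Monotone (a k) := fun k => monotone_nat_of_le_succ fun n => by
    linarith [a_succ k n, ht₀ (a k n) n, step_nonneg k n]
  have hanti : ∀ k, Antitone fun n => a k n + len n := fun k => antitone_nat_of_succ_le fun n => by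
    linarith [a_succ k n, ht₁ (a k n) n, step_le k n]
  have hX : ∀ k n, (⨆ m, a k m) ∈ Set.Icc (a k n) (a k n + len n) := fun k =>
    Set.mem_iInter.1 ((hmono k).ciSup_mem_iInter_Icc_of_antitone (hanti k)
      fun n => by linarith [len_pos n])
  have len_zero : len 0 = 1 / 2 := by simp [hlen]
  have hfar : ∀ k n (p q : ℤ), 1 ≤ q → 2 * (q : ℝ) ^ 2 * len n ≤ 1 →
      len n / 4 ≤ |(⨆ m, a k m) - p / q| := fun k n p q hq h => by
    obtain ⟨h₁, h₂⟩ := hX k (n + 1)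
    refine ht (a k n) n p q hq h _ ⟨?_, ?_⟩ <;>
      linarith [a_succ k n, step_le k n, step_nonneg k n]
  refine ⟨fun k => ⨆ m, a k m, fun k => ⟨?_, fun p q hq => ?_⟩, fun k k' n heq hne => ?_⟩
  · obtain ⟨h₁, h₂⟩ := hX k 0
    have : a k 0 = 0 := rfl
    constructor <;> linarith
  · have hq1 : (1 : ℝ) ≤ q := by exact_mod_cast hq
    have hq2 : (1 : ℝ) ≤ (q : ℝ) ^ 2 := one_le_pow₀ hq1
    have hex : ∃ n, 2 * (q : ℝ) ^ 2 * len n ≤ 1 := by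
      obtain ⟨n, hn⟩ := pow_unbounded_of_one_lt ((q : ℝ) ^ 2) (show (1 : ℝ) < 8 * N by linarith)
      refine ⟨n, ?_⟩
      have : 2 * (q : ℝ) ^ 2 * len n = (q : ℝ) ^ 2 / (8 * N : ℝ) ^ n := by
        simp only [hlen]
        field_simp
      rw [this, div_le_one (by positivity)]
      exact hn.le
    classical
    refine le_trans ?_ (hfar k (Nat.find hex) p q hq (Nat.find_spec hex))
    rw [div_div, div_le_iff₀ (by positivity)]
    rcases hn : Nat.find hex with _ | m
    · rw [len_zero]
      nlinarith
    · have hm := Nat.find_min hex (m := m) (by omega)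
      rw [not_le, ← len_succ] at hm
      linarith
  · have ha : ∀ m ≤ n, a k m = a k' m := fun m hm => by
      induction m with
      | zero => rfl
      | succ m ih => rw [a_succ, a_succ, ih (by omega), heq m (by omega)]
    have hk : (1 : ℝ) ≤ |((k n : ℕ) : ℝ) - (k' n : ℕ)| := by
      have : ((k n : ℕ) : ℤ) - (k' n : ℕ) ≠ 0 := by
        rw [sub_ne_zero]
        exact_mod_cast fun h => hne (Fin.ext h)
      exact_mod_cast Int.one_le_abs this
    obtain ⟨h₁, h₂⟩ := hX k (n + 1)
    obtain ⟨h₁', h₂'⟩ := hX k' (n + 1)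
    have e := a_succ k n
    have e' := a_succ k' n
    rw [← ha n le_rfl] at e'
    change len (n + 1) ≤ _
    have := len_pos (n + 1)
    rw [le_abs] at hk ⊢
    rcases hk with hk | hk
    · left; nlinarith
    · right; nlinarith

/-- For every exponent `s < 1` some base `N` satisfies `(8 * N) ^ s ≤ N`. -/
theorem exists_eight_mul_rpow_le {s : ℝ} (hs : s < 1) :
    ∃ N : ℕ, 2 ≤ N ∧ (8 * N : ℝ) ^ s ≤ N := by
  have hlim : Filter.Tendsto (fun N : ℕ => (N : ℝ) ^ (1 - s)) Filter.atTop Filter.atTop :=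
    (tendsto_rpow_atTop (by linarith)).comp tendsto_natCast_atTop_atTop
  obtain ⟨N, h8, hN⟩ := ((hlim.eventually_ge_atTop ((8 : ℝ) ^ s)).and
    (Filter.eventually_ge_atTop 2)).exists
  have hN0 : (0 : ℝ) < N := by exact_mod_cast (by omega : 0 < N)
  refine ⟨N, hN, ?_⟩
  calc (8 * N : ℝ) ^ s = 8 ^ s * (N : ℝ) ^ s := Real.mul_rpow (by norm_num) hN0.le
    _ ≤ (N : ℝ) ^ (1 - s) * (N : ℝ) ^ s := by gcongr
    _ = N := by rw [← Real.rpow_add hN0]; simp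

/-- A Cantor set coded by the sequences of `N` digits, in which sequences that
differ in the digit `n` give points that are `(8 * N) ^ (-(n + 1)) / 2` apart, has dimension at
least `s` as soon as `(8 * N) ^ s ≤ N`. -/
theorem le_dimH_range_of_separated_coding {N : ℕ} (hN : 2 ≤ N) {s : NNReal} (hs : 0 < s)
    (hNs : (8 * N : ℝ) ^ (s : ℝ) ≤ N) {X : (ℕ → Fin N) → ℝ}
    (hX : ∀ k k' n, (∀ i < n, k i = k' i) → k n ≠ k' n →
      ((8 * N : ℝ) ^ (n + 1))⁻¹ / 2 ≤ |X k - X k'|) :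
    (s : ENNReal) ≤ dimH (Set.range X) := by
  have hN0 : (0 : ℝ) < N := by exact_mod_cast (by omega : 0 < N)
  have : Nonempty (Fin N) := ⟨⟨0, by omega⟩⟩
  have hfirst : ∀ k k' : ℕ → Fin N, k ≠ k' → ∃ n, (∀ i < n, k i = k' i) ∧ k n ≠ k' n := by
    classical
    intro k k' hne
    have hex := Function.ne_iff.1 hne
    exact ⟨Nat.find hex, fun i hi => not_not.1 (Nat.find_min hex hi), Nat.find_spec hex⟩
  have hinj : Function.Injective X := fun k k' h => by
    by_contra hne
    obtain ⟨n, hn, hn'⟩ := hfirst k k' hne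
    have := hX k k' n hn hn'
    rw [h, sub_self, abs_zero] at this
    exact absurd this (not_le.2 (by positivity))
  set C : NNReal := N * 2 ^ (s : ℝ) with hC
  have hholder : HolderOnWith C s (fun x => Real.ofDigits (Function.invFun X x))
      (Set.range X) := by
    rintro _ ⟨k, rfl⟩ _ ⟨k', rfl⟩
    simp only [Function.leftInverse_invFun hinj _]
    rcases eq_or_ne k k' with rfl | hne
    · simp
    obtain ⟨n, hn, hn'⟩ := hfirst k k' hne
    have hsep := hX k k' n hn hn'
    have key : |Real.ofDigits k - Real.ofDigits k'| ≤ C * |X k - X k'| ^ (s : ℝ) :=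
      calc |Real.ofDigits k - Real.ofDigits k'| ≤ ((N : ℝ) ^ n)⁻¹ :=
            Real.abs_ofDigits_sub_ofDigits_le hn
        _ = N * ((N : ℝ) ^ (n + 1))⁻¹ := by rw [pow_succ]; field_simp
        _ ≤ N * (((8 * N : ℝ) ^ (s : ℝ)) ^ (n + 1))⁻¹ := by gcongr
        _ = C * (((8 * N : ℝ) ^ (n + 1))⁻¹ / 2) ^ (s : ℝ) := by
            rw [Real.div_rpow (by positivity) (by norm_num), Real.inv_rpow (by positivity),
              ← Real.rpow_natCast, ← Real.rpow_natCast, ← Real.rpow_mul (by positivity),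
              ← Real.rpow_mul (by positivity), mul_comm (s : ℝ), hC]
            push_cast
            field_simp
        _ ≤ C * |X k - X k'| ^ (s : ℝ) := by gcongr
    rw [edist_dist, edist_dist, Real.dist_eq, Real.dist_eq,
      ENNReal.ofReal_rpow_of_nonneg (abs_nonneg _) s.coe_nonneg, ← ENNReal.ofReal_coe_nnreal,
      ← ENNReal.ofReal_mul C.coe_nonneg]
    exact ENNReal.ofReal_le_ofReal key
  have himage : Set.Icc (0 : ℝ) 1 ⊆
      (fun x => Real.ofDigits (Function.invFun X x)) '' Set.range X := by
    intro y hy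
    obtain ⟨k, -, hk⟩ := Real.ofDigits_SurjOn (b := N) (by omega) hy
    refine ⟨X k, ⟨k, rfl⟩, ?_⟩
    simp only [Function.leftInverse_invFun hinj _]
    exact hk
  have hIcc : dimH (Set.Icc (0 : ℝ) 1) = 1 := by
    rw [Real.dimH_of_nonempty_interior (by simp)]
    simp
  have hle := (dimH_mono himage).trans (hholder.dimH_image_le hs)
  rw [hIcc, ENNReal.le_div_iff_mul_le (by simp [hs.ne']) (by simp), one_mul] at hle
  exact hle

/-- The Gauss map orbit of a number that is badly approximable with constant `c` stays in
`[c, 1]`. -/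
theorem IsBadlyApproximableWith.le_gaussMap_iterate {c : ℝ} (hc : 0 < c)
    {T : Set.Icc (0 : ℝ) 1 → Set.Icc (0 : ℝ) 1}
    (hT : ∀ x : Set.Icc (0 : ℝ) 1,
      (T x : ℝ) = if (x : ℝ) = 0 then 0 else Int.fract (1 / (x : ℝ)))
    {x : Set.Icc (0 : ℝ) 1} (hx : IsBadlyApproximableWith c (x : ℝ)) (n : ℕ) :
    c ≤ (T^[n] x : ℝ) := by
  have hlow : ∀ (ε : ℝ) (p q : ℤ), |ε| = 1 → 1 ≤ q → 0 ≤ ε * (q * x - p) →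
      c ≤ ε * (q * x - p) * q := by
    intro ε p q hε hq hnonneg
    have hq0 : (0 : ℝ) < q := by exact_mod_cast hq
    have h := hx p q hq
    have hu : ε * (q * x - p) = q * |(x : ℝ) - p / q| := by
      rw [← abs_of_nonneg hnonneg, abs_mul, hε, one_mul, ← abs_of_pos hq0, ← abs_mul,
        abs_of_pos hq0, mul_sub, mul_div_cancel₀ _ hq0.ne']
    rw [div_le_iff₀ (by positivity)] at h
    rw [hu]
    linarith
  obtain ⟨ε, p, q, p', q', v, hε, hq, hq', hu, hv, hdet, hTn⟩ :
      ∃ (ε : ℝ) (p q p' q' : ℤ) (v : ℝ), |ε| = 1 ∧ 1 ≤ q ∧ 0 ≤ q' ∧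
        0 < ε * (q * x - p) ∧ v = -ε * (q' * x - p') ∧
        q * v + q' * (ε * (q * x - p)) = 1 ∧ (T^[n] x : ℝ) * v = ε * (q * x - p) := by
    induction n with
    | zero =>
      have h0 : (0 : ℝ) < x := by
        refine lt_of_le_of_ne x.2.1 fun h => ?_
        have := hx 0 1 le_rfl
        rw [← h] at this
        norm_num at this
        linarith
      exact ⟨1, 0, 1, 1, 0, 1, by simp, le_rfl, le_rfl, by simpa using h0, by simp, by simp,
        by simp⟩
    | succ n ih =>
      obtain ⟨ε, p, q, p', q', v, hε, hq, hq', hu, hv, hdet, hTn⟩ := ih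
      set y : ℝ := (T^[n] x : ℝ)
      have hy0 : 0 < y := by
        refine lt_of_le_of_ne (T^[n] x).2.1 fun h => ?_
        rw [← h, zero_mul] at hTn
        linarith
      have hy1 : y ≤ 1 := (T^[n] x).2.2
      have ha : 1 ≤ ⌊1 / y⌋ := by
        rw [Int.le_floor]
        simpa using (one_le_div hy0).2 hy1
      have hTy : (T^[n + 1] x : ℝ) = 1 / y - ⌊1 / y⌋ := by
        rw [Function.iterate_succ_apply', hT, if_neg hy0.ne']
        rfl
      set a : ℤ := ⌊1 / y⌋
      have hnext : (T^[n + 1] x : ℝ) * (ε * (q * x - p)) =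
          -ε * ((a * q + q' : ℤ) * x - (a * p + p' : ℤ)) := by
        rw [hTy, sub_mul, ← hTn, ← mul_assoc, one_div_mul_cancel hy0.ne', hTn, hv]
        push_cast
        ring
      have hqn : 1 ≤ a * q + q' := by nlinarith
      have hnonneg : 0 ≤ -ε * ((a * q + q' : ℤ) * x - (a * p + p' : ℤ)) :=
        hnext ▸ mul_nonneg (T^[n + 1] x).2.1 hu.le
      refine ⟨-ε, a * p + p', a * q + q', p, q, ε * (q * x - p), by rwa [abs_neg], hqn, by omega,
        ?_, by ring, ?_, hnext⟩
      · refine lt_of_le_of_ne hnonneg fun h => ?_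
        have := hlow (-ε) _ _ (by rwa [abs_neg]) hqn hnonneg
        rw [← h, zero_mul] at this
        linarith
      · rw [hv] at hdet
        push_cast
        linear_combination hdet
  have hq0 : (0 : ℝ) < q := by exact_mod_cast hq
  have hqv : q * v ≤ 1 := by
    have : 0 ≤ (q' : ℝ) * (ε * (q * x - p)) := mul_nonneg (by exact_mod_cast hq') hu.le
    linarith
  have h := hlow ε p q hε hq hu.le
  rw [← hTn] at h
  nlinarith [(T^[n] x).2.1]

/-- For the Gauss map `T` on `[0,1]` (`T 0 = 0`, `T x = 1/x mod 1`
for `x ≠ 0`), the set `{x ∈ [0,1] : liminf_n |T^n x| > 0}` has Hausdorff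
dimension `1`. -/
theorem gaussMap_badly_approximable_full_dimH
    (T : Set.Icc (0:ℝ) 1 → Set.Icc (0:ℝ) 1)
    (hT : ∀ x : Set.Icc (0:ℝ) 1,
      ((T x : ℝ)) = if (x : ℝ) = 0 then 0 else Int.fract (1 / (x : ℝ))) :
    dimH {x : Set.Icc (0:ℝ) 1 |
      0 < Filter.liminf (fun n => |((T^[n] x : ℝ))|) Filter.atTop} = 1 := by
  set S : Set (Set.Icc (0 : ℝ) 1) :=
    {x | 0 < Filter.liminf (fun n => |((T^[n] x : ℝ))|) Filter.atTop}
  rw [← isometry_subtype_coe.dimH_image S]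
  apply le_antisymm
  · calc dimH (Subtype.val '' S) ≤ dimH (Set.univ : Set ℝ) := dimH_mono (Set.subset_univ _)
      _ = 1 := by rw [Real.dimH_univ]
  · refine ENNReal.le_of_forall_nnreal_lt fun s hs => ?_
    rcases eq_zero_or_pos s with rfl | hs0
    · simp
    obtain ⟨N, hN, hNs⟩ := exists_eight_mul_rpow_le (s := s) (by exact_mod_cast hs)
    obtain ⟨X, hbad, hsep⟩ := exists_badlyApproximable_coding (N := N) (by omega)
    refine (le_dimH_range_of_separated_coding hN hs0 hNs hsep).trans (dimH_mono ?_)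
    rintro _ ⟨k, rfl⟩
    have hc : (0 : ℝ) < 1 / (64 * N) := by
      have : (0 : ℝ) < N := by exact_mod_cast (by omega : 0 < N)
      positivity
    refine ⟨⟨X k, (hbad k).1⟩, lt_of_lt_of_le hc (Filter.le_liminf_of_le ?_ ?_), rfl⟩
    · refine Filter.IsBoundedUnder.isCoboundedUnder_ge ⟨1, ?_⟩
      refine Filter.eventually_map.2 (Filter.Eventually.of_forall fun n => ?_)
      rw [abs_of_nonneg (T^[n] _).2.1]
      exact (T^[n] _).2.2
    · exact Filter.Eventually.of_forall fun n =>
        ((hbad k).2.le_gaussMap_iterate hc hT n).trans (le_abs_self _)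
end

section
/- Let γ > 1 be an integer and let T : [0,1] → [0,1] be the map T x = γx mod 1. Then for every y ∈ [0,1] and every α ∈ (0, 1/2), the set {x ∈ [0,1] : liminf_{n→∞} |T^n x − y| > 0} is α-winning for Schmidt's game on [0,1]. -/
/-- Schmidt's `(α, β)`-game on a metric space `X`: Bob plays closed balls
`B(z k, r k)` with `r (k+1) = β * (α * r k)`, Alice (given the history of Bob's
moves so far) plays the center of a closed ball of radius `α * r k` which must be
contained in Bob's current ball, and Bob must play inside Alice's ball.  A set `S`
is `(α, β)`-winning if Alice has a strategy whose moves are always legal and which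
guarantees that `⋂ k, B(z k, r k)` meets `S`, for every legal play by Bob. -/
def SchmidtWinning {X : Type*} [MetricSpace X] (S : Set X) (α β : ℝ) : Prop :=
  ∃ strat : List (X × ℝ) → X,
    ∀ (z : ℕ → X) (r : ℕ → ℝ),
      0 < r 0 →
      (∀ k, r (k + 1) = β * (α * r k)) →
      (∀ k, Metric.closedBall (z (k + 1)) (r (k + 1)) ⊆
        Metric.closedBall (strat ((List.range (k + 1)).map fun i => (z i, r i)))
          (α * r k)) →
      (∀ k, Metric.closedBall (strat ((List.range (k + 1)).map fun i => (z i, r i)))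
          (α * r k) ⊆ Metric.closedBall (z k) (r k)) ∧
        ((⋂ k, Metric.closedBall (z k) (r k)) ∩ S).Nonempty

/-- The translates `v + m` of a real number by integers are zero or bounded away from zero. -/
lemma exists_pos_forall_add_int_eq_zero_or_le_abs (v : ℝ) :
    ∃ ε > 0, ∀ m : ℤ, v + m = 0 ∨ ε ≤ |v + m| := by
  have hv := Int.floor_add_fract v
  rcases eq_or_lt_of_le (Int.fract_nonneg v) with h | h
  · refine ⟨1, one_pos, fun m => ?_⟩
    have e : v + m = ((⌊v⌋ + m : ℤ) : ℝ) := by push_cast; linarith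
    rw [e, ← Int.cast_abs]
    by_cases h0 : ⌊v⌋ + m = 0
    · left; exact_mod_cast h0
    · right; exact_mod_cast Int.one_le_abs h0
  · have h1 := Int.fract_lt_one v
    refine ⟨min (Int.fract v) (1 - Int.fract v), lt_min h (by linarith), fun m => Or.inr ?_⟩
    have e : v + m = Int.fract v + ((⌊v⌋ + m : ℤ) : ℝ) := by push_cast; linarith
    rw [e]
    rcases le_or_gt 0 (⌊v⌋ + m) with hm | hm
    · have : (0 : ℝ) ≤ ((⌊v⌋ + m : ℤ) : ℝ) := by exact_mod_cast hm
      exact (min_le_left _ _).trans ((by linarith : _ ≤ _).trans (le_abs_self _))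
    · have : ((⌊v⌋ + m : ℤ) : ℝ) ≤ -1 := by exact_mod_cast (by omega : ⌊v⌋ + m ≤ -1)
      exact (min_le_right _ _).trans ((by linarith : _ ≤ _).trans (neg_le_abs _))

/-- Finitely many real numbers have integer translates that are uniformly bounded away from zero,
unless they vanish. -/
lemma exists_pos_forall_lt_add_int_eq_zero_or_le_abs (v : ℕ → ℝ) (N : ℕ) :
    ∃ ε > 0, ∀ k < N, ∀ m : ℤ, v k + m = 0 ∨ ε ≤ |v k + m| := by
  induction N with
  | zero => exact ⟨1, one_pos, by simp⟩
  | succ N ih =>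
    obtain ⟨ε, hε, h⟩ := ih
    obtain ⟨δ, hδ, h'⟩ := exists_pos_forall_add_int_eq_zero_or_le_abs (v N)
    refine ⟨min ε δ, lt_min hε hδ, fun k hk m => ?_⟩
    rcases Nat.lt_succ_iff_lt_or_eq.mp hk with hk | rfl
    · exact (h k hk m).imp_right (min_le_left _ _).trans
    · exact (h' m).imp_right (min_le_right _ _).trans

/-- The preimages of `y` under `x ↦ γ ^ n x mod 1`, for the scales `n` at which
`ε * γ ^ (-n)` lies in `[r, r / q)`. -/
def preimagesAtScale (γ y ε q r : ℝ) : Set ℝ :=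
  {p | ∃ (n : ℕ) (j : ℤ), γ ^ n * p = y + j ∧ r * γ ^ n ≤ ε ∧ q * ε < r * γ ^ n}

/-- For suitable `ε`, any interval of radius `2 r` holds at most one point of
`preimagesAtScale γ y ε q r`. -/
lemma exists_preimagesAtScale_subsingleton (γ : ℤ) (hγ : 1 < γ) (y q : ℝ) (hq : 0 < q) :
    ∃ ε > 0, ∀ r > 0, ∀ z : ℝ,
      (preimagesAtScale γ y ε q r ∩ Metric.closedBall z (2 * r)).Subsingleton := by
  have hγ' : (1 : ℝ) < γ := by exact_mod_cast hγ
  obtain ⟨N, hN⟩ := pow_unbounded_of_one_lt (1 / q) hγ'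
  rw [div_lt_iff₀ hq] at hN
  obtain ⟨ε, hε, hsep⟩ :=
    exists_pos_forall_lt_add_int_eq_zero_or_le_abs (fun k => ((γ : ℝ) ^ k - 1) * y) N
  have key : ∀ r > 0, ∀ (n k : ℕ) (i j : ℤ) (p p' : ℝ),
      (γ : ℝ) ^ n * p = y + i → (γ : ℝ) ^ (n + k) * p' = y + j →
      q * (ε / 5) < r * (γ : ℝ) ^ n → r * (γ : ℝ) ^ (n + k) ≤ ε / 5 →
      |p - p'| ≤ 4 * r → p = p' := by
    intro r hr n k i j p p' hp hp' h1 h2 hd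
    have hpos : (0 : ℝ) < (γ : ℝ) ^ n := by positivity
    have hpos' : (0 : ℝ) < (γ : ℝ) ^ (n + k) := by positivity
    have hk : k < N := by
      by_contra! hNk
      have h3 : (γ : ℝ) ^ N ≤ (γ : ℝ) ^ k := pow_le_pow_right₀ hγ'.le hNk
      have h4 : 1 < (γ : ℝ) ^ k * q := hN.trans_le (by gcongr)
      have h5 : q * (r * (γ : ℝ) ^ (n + k)) ≤ q * (ε / 5) := by gcongr
      rw [pow_add] at h5
      nlinarith [mul_pos hr hpos]
    have e : (γ : ℝ) ^ (n + k) * (p - p') =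
        ((γ : ℝ) ^ k - 1) * y + ((γ ^ k * i - j : ℤ) : ℝ) := by
      push_cast
      rw [mul_sub, hp', pow_add]
      linear_combination (γ : ℝ) ^ k * hp
    rcases hsep k hk (γ ^ k * i - j) with h | h
    · rw [← e] at h
      have := (mul_eq_zero.mp h).resolve_left hpos'.ne'
      linarith
    · rw [← e, abs_mul, abs_of_pos hpos'] at h
      nlinarith [mul_le_mul_of_nonneg_left hd hpos'.le]
  refine ⟨ε / 5, by positivity, ?_⟩
  rintro r hr z p ⟨⟨n, i, hp, h1, h2⟩, hpz⟩ p' ⟨⟨n', j, hp', h1', h2'⟩, hpz'⟩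
  have hd : |p - p'| ≤ 4 * r := by
    rw [Metric.mem_closedBall, Real.dist_eq, abs_le] at hpz hpz'
    rw [abs_le]; constructor <;> linarith
  rcases le_total n n' with h | h
  · obtain ⟨k, rfl⟩ := Nat.exists_eq_add_of_le h
    exact key r hr n k i j p p' hp hp' h2 h1' hd
  · obtain ⟨k, rfl⟩ := Nat.exists_eq_add_of_le h
    exact (key r hr n' k j i p' p hp' hp h2' h1 (by rwa [abs_sub_comm])).symm

/-- Inside an interval of radius `r`, an interval of radius `α * r` touching one of its ends stays
away from a set with at most one point in the doubled interval. -/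
lemma exists_interval_avoiding {α r z : ℝ} (hα : 0 < α) (hα' : α < 1 / 2) (hr : 0 < r)
    {P : Set ℝ} (hP : (P ∩ Metric.closedBall z (2 * r)).Subsingleton) :
    ∃ c : ℝ, |c - z| ≤ (1 - α) * r ∧
      ∀ p ∈ P, ∀ x, |x - c| ≤ α * r → (1 - 2 * α) * r ≤ |x - p| := by
  have hαr : 0 < α * r := mul_pos hα hr
  have hαr' : α * r < 1 / 2 * r := mul_lt_mul_of_pos_right hα' hr
  have far : ∀ c p x : ℝ, |c - z| ≤ (1 - α) * r → |x - c| ≤ α * r →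
      p ∉ Metric.closedBall z (2 * r) → (1 - 2 * α) * r ≤ |x - p| := by
    intro c p x hc hx hp
    rw [Metric.mem_closedBall, Real.dist_eq, not_le] at hp
    have h := abs_sub_le p x z
    have h' := abs_sub_le x c z
    rw [abs_sub_comm p x] at h
    linarith
  rcases hP.eq_empty_or_singleton with h | ⟨p₀, h⟩
  · refine ⟨z, by rw [sub_self, abs_zero]; nlinarith, fun p hp x hx => ?_⟩
    refine far z p x (by rw [sub_self, abs_zero]; nlinarith) hx fun hp' => ?_
    have : p ∈ (∅ : Set ℝ) := h ▸ ⟨hp, hp'⟩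
    exact this
  · have eq_of_mem : ∀ p ∈ P, p ∈ Metric.closedBall z (2 * r) → p = p₀ := fun p hp hp' => by
      have : p ∈ ({p₀} : Set ℝ) := h ▸ ⟨hp, hp'⟩
      exact this
    have aux : ∀ c : ℝ, |c - z| ≤ (1 - α) * r →
        (∀ x, |x - c| ≤ α * r → (1 - 2 * α) * r ≤ |x - p₀|) →
        ∀ p ∈ P, ∀ x, |x - c| ≤ α * r → (1 - 2 * α) * r ≤ |x - p| := by
      intro c hc hx₀ p hp x hx
      by_cases hp' : p ∈ Metric.closedBall z (2 * r)
      · rw [eq_of_mem p hp hp']; exact hx₀ x hx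
      · exact far c p x hc hx hp'
    rcases le_total z p₀ with hz | hz
    · have hc : |z - (1 - α) * r - z| ≤ (1 - α) * r := by
        rw [abs_le]; constructor <;> linarith
      refine ⟨_, hc, aux _ hc fun x hx => ?_⟩
      rw [abs_le] at hx
      exact le_trans (by linarith) (neg_le_abs _)
    · have hc : |z + (1 - α) * r - z| ≤ (1 - α) * r := by
        rw [abs_le]; constructor <;> linarith
      refine ⟨_, hc, aux _ hc fun x hx => ?_⟩
      rw [abs_le] at hx
      exact le_trans (by linarith) (le_abs_self _)

/-- A move for Alice on `[0,1]`: it leaves the end points of `[0,1]` behind, and avoids a given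
sparse set if Bob's ball is already away from these end points. -/
lemma exists_unitInterval_move {α r : ℝ} (hα : 0 < α) (hα' : α < 1 / 2) (hr : 0 < r)
    (z : Set.Icc (0 : ℝ) 1) {P : Set ℝ}
    (hP : (P ∩ Metric.closedBall (z : ℝ) (2 * r)).Subsingleton) :
    ∃ c : Set.Icc (0 : ℝ) 1, Metric.closedBall c (α * r) ⊆ Metric.closedBall z r ∧
      (r < 1 / 2 → 0 < c - α * r ∧ c + α * r < 1) ∧
      (0 < z - r → z + r < 1 →
        ∀ p ∈ P, ∀ x : ℝ, |x - c| ≤ α * r → (1 - 2 * α) * r ≤ |x - p|) := by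
  have hαr : 0 < α * r := mul_pos hα hr
  have hαr' : α * r < 1 / 2 * r := mul_lt_mul_of_pos_right hα' hr
  have sub : ∀ c : Set.Icc (0 : ℝ) 1, |(c : ℝ) - z| ≤ (1 - α) * r →
      Metric.closedBall c (α * r) ⊆ Metric.closedBall z r := fun c hc =>
    Metric.closedBall_subset_closedBall' (by rw [Subtype.dist_eq, Real.dist_eq]; linarith)
  obtain ⟨hz0, hz1⟩ := z.2
  by_cases hin : 0 < (z : ℝ) - r ∧ (z : ℝ) + r < 1
  · obtain ⟨c, hc, hcP⟩ := exists_interval_avoiding hα hα' hr hP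
    have hc' := abs_le.mp hc
    exact ⟨⟨c, by linarith, by linarith⟩, sub _ hc,
      fun _ => ⟨by dsimp only; linarith, by dsimp only; linarith⟩, fun _ _ => hcP⟩
  · rcases le_or_gt (1 / 2) r with hr2 | hr2
    · exact ⟨z, sub z (by rw [sub_self, abs_zero]; nlinarith), fun h => absurd h (by linarith),
        fun h h' => absurd ⟨h, h'⟩ hin⟩
    rcases le_or_gt (z : ℝ) (1 / 2) with hz | hz
    · refine ⟨⟨z + (1 - α) * r, by linarith, by linarith⟩, sub _ ?_, fun _ => ⟨?_, ?_⟩,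
        fun h h' => absurd ⟨h, h'⟩ hin⟩
      · rw [abs_le]; constructor <;> dsimp only <;> linarith
      · dsimp only; linarith
      · dsimp only; linarith
    · refine ⟨⟨z - (1 - α) * r, by linarith, by linarith⟩, sub _ ?_, fun _ => ⟨?_, ?_⟩,
        fun h h' => absurd ⟨h, h'⟩ hin⟩
      · rw [abs_le]; constructor <;> dsimp only <;> linarith
      · dsimp only; linarith
      · dsimp only; linarith

/-- A ball of `[0,1]` contained in a ball away from the end points is away from them too. -/
lemma unitInterval_ball_interior {z c : Set.Icc (0 : ℝ) 1} {r s : ℝ} (hr : 0 ≤ r)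
    (h : Metric.closedBall z r ⊆ Metric.closedBall c s) (h0 : 0 < c - s) (h1 : c + s < 1) :
    0 < (z : ℝ) - r ∧ (z : ℝ) + r < 1 := by
  obtain ⟨hz0, hz1⟩ := z.2
  constructor
  · by_contra! hz
    have h2 : (⟨0, by simp⟩ : Set.Icc (0 : ℝ) 1) ∈ Metric.closedBall z r := by
      rw [Metric.mem_closedBall, Subtype.dist_eq, Real.dist_eq, abs_le]
      constructor <;> dsimp only <;> linarith
    have h3 := h h2
    rw [Metric.mem_closedBall, Subtype.dist_eq, Real.dist_eq, abs_le] at h3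
    dsimp only at h3
    linarith
  · by_contra! hz
    have h2 : (⟨1, by simp⟩ : Set.Icc (0 : ℝ) 1) ∈ Metric.closedBall z r := by
      rw [Metric.mem_closedBall, Subtype.dist_eq, Real.dist_eq, abs_le]
      constructor <;> dsimp only <;> linarith
    have h3 := h h2
    rw [Metric.mem_closedBall, Subtype.dist_eq, Real.dist_eq, abs_le] at h3
    dsimp only at h3
    linarith

lemma coe_iterate_eq_fract (γ : ℤ) (T : Set.Icc (0:ℝ) 1 → Set.Icc (0:ℝ) 1)
    (hT : ∀ x : Set.Icc (0:ℝ) 1, ((T x : ℝ)) = Int.fract ((γ : ℝ) * (x : ℝ)))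
    (x : Set.Icc (0:ℝ) 1) {n : ℕ} (hn : n ≠ 0) :
    (T^[n] x : ℝ) = Int.fract ((γ : ℝ) ^ n * x) := by
  induction n with
  | zero => exact absurd rfl hn
  | succ n ih =>
    rw [Function.iterate_succ_apply', hT]
    rcases eq_or_ne n 0 with rfl | h
    · simp
    · rw [ih h, Int.fract_eq_fract]
      refine ⟨-(γ * ⌊(γ : ℝ) ^ n * x⌋), ?_⟩
      push_cast
      rw [Int.fract]
      ring

/-- For the `γ`-adic map `T x = γ x mod 1` on `[0,1]` with integer
`γ > 1` and any target `y ∈ [0,1]`, the set `{x : liminf_n |T^n x - y| > 0}` is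
`α`-winning for Schmidt's game on `[0,1]` for every `α ∈ (0, 1/2)`. -/
theorem betaMap_nonshrinking_target_schmidt_winning
    (γ : ℤ) (hγ : 1 < γ)
    (T : Set.Icc (0:ℝ) 1 → Set.Icc (0:ℝ) 1)
    (hT : ∀ x : Set.Icc (0:ℝ) 1, ((T x : ℝ)) = Int.fract ((γ : ℝ) * (x : ℝ)))
    (y : Set.Icc (0:ℝ) 1) (α : ℝ) (hα : α ∈ Set.Ioo (0:ℝ) (1/2)) :
    ∀ β ∈ Set.Ioo (0:ℝ) 1,
      SchmidtWinning
        {x : Set.Icc (0:ℝ) 1 |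
          0 < Filter.liminf (fun n => |((T^[n] x : ℝ)) - (y : ℝ)|) Filter.atTop}
        α β := by
  rintro β ⟨hβ, hβ'⟩
  obtain ⟨hα, hα'⟩ := hα
  have hγ' : (1 : ℝ) < γ := by exact_mod_cast hγ
  have hq : 0 < β * α := mul_pos hβ hα
  have hq1 : β * α < 1 := by nlinarith
  obtain ⟨ε, hε, hsub⟩ := exists_preimagesAtScale_subsingleton γ hγ y (β * α) hq
  choose! F hF using fun (z : Set.Icc (0 : ℝ) 1) (r : ℝ) (hr : 0 < r) =>
    exists_unitInterval_move hα hα' hr z (hsub r hr z)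
  refine ⟨fun l => (l.getLast?.map fun a => F a.1 a.2).getD y, fun z r hr0 hr hlegal => ?_⟩
  simp only [List.range_succ, List.map_append, List.map_cons, List.map_nil,
    List.getLast?_append_cons, List.getLast?_singleton, Option.map_some, Option.getD_some]
    at hlegal ⊢
  have hrpow : ∀ k, r k = (β * α) ^ k * r 0 := by
    intro k
    induction k with
    | zero => simp
    | succ k ih => rw [hr, ih]; ring
  have hrpos : ∀ k, 0 < r k := fun k => by rw [hrpow]; positivity
  have hmove := fun k => hF (z k) (r k) (hrpos k)
  refine ⟨fun k => (hmove k).1, ?_⟩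
  have hranti : Antitone r := antitone_nat_of_succ_le fun k => by
    rw [hr]; nlinarith [hrpos k]
  have hlim : Filter.Tendsto r Filter.atTop (nhds 0) := by
    rw [funext hrpow]
    simpa using (tendsto_pow_atTop_nhds_zero_of_lt_one hq.le hq1).mul_const (r 0)
  obtain ⟨x, hx⟩ : (⋂ k, Metric.closedBall (z k) (r k)).Nonempty :=
    IsCompact.nonempty_iInter_of_sequence_nonempty_isCompact_isClosed _
      (fun k => (hlegal k).trans (hmove k).1)
      (fun k => ⟨z k, Metric.mem_closedBall_self (hrpos k).le⟩)
      Metric.isClosed_closedBall.isCompact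
      (fun k => Metric.isClosed_closedBall)
  refine ⟨x, hx, ?_⟩
  rw [Set.mem_iInter] at hx
  obtain ⟨K, hK⟩ := (hlim.eventually_lt_const (by norm_num : (0 : ℝ) < 1 / 2)).exists
  have hinterior : ∀ k > K, 0 < (z k : ℝ) - r k ∧ (z k : ℝ) + r k < 1 := by
    intro k hk
    obtain ⟨k, rfl⟩ := Nat.exists_eq_add_of_lt hk
    obtain ⟨h0, h1⟩ := (hmove (K + k)).2.1 ((hranti (Nat.le_add_right K k)).trans_lt hK)
    exact unitInterval_ball_interior (hrpos _).le (hlegal (K + k)) h0 h1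
  obtain ⟨M, hM⟩ := pow_unbounded_of_one_lt (ε / r (K + 1)) hγ'
  rw [div_lt_iff₀ (hrpos _)] at hM
  have hc : 0 < (1 - 2 * α) * (β * α * ε) := mul_pos (by linarith) (mul_pos hq hε)
  have hbound : ∀ n ≥ M + 1, (1 - 2 * α) * (β * α * ε) ≤ |(T^[n] x : ℝ) - y| := by
    intro n hn
    have hpos : (0 : ℝ) < (γ : ℝ) ^ n := by positivity
    have hex : ∃ k, r k * (γ : ℝ) ^ n ≤ ε := by
      obtain ⟨k, hk⟩ := (hlim.eventually_lt_const (div_pos hε hpos)).exists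
      exact ⟨k, ((lt_div_iff₀ hpos).mp hk).le⟩
    classical
    obtain ⟨k, hk⟩ : ∃ k, Nat.find hex = K + 1 + k + 1 := by
      refine Nat.exists_eq_add_of_lt ((Nat.lt_find_iff hex _).mpr fun m hm => not_le.mpr ?_)
      calc ε < (γ : ℝ) ^ M * r (K + 1) := hM
        _ ≤ (γ : ℝ) ^ n * r m := by
          have := hrpos (K + 1)
          gcongr
          · exact hγ'.le
          · omega
          · exact hranti hm
        _ = r m * (γ : ℝ) ^ n := mul_comm _ _
    have h1 : r (K + 1 + k + 1) * (γ : ℝ) ^ n ≤ ε := hk ▸ Nat.find_spec hex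
    have h2 : ε < r (K + 1 + k) * (γ : ℝ) ^ n :=
      not_le.mp (Nat.find_min hex (by omega))
    have h3 : β * α * ε < r (K + 1 + k + 1) * (γ : ℝ) ^ n := by
      rw [hr]
      calc β * α * ε < β * α * (r (K + 1 + k) * (γ : ℝ) ^ n) := by gcongr
        _ = _ := by ring
    obtain ⟨hz0, hz1⟩ := hinterior (K + 1 + k + 1) (by omega)
    have hxA := hlegal (K + 1 + k + 1) (hx _)
    rw [Metric.mem_closedBall, Subtype.dist_eq, Real.dist_eq] at hxA
    have h4 := (hmove (K + 1 + k + 1)).2.2 hz0 hz1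
      (((y : ℝ) + ⌊(γ : ℝ) ^ n * x⌋) / (γ : ℝ) ^ n)
      ⟨n, ⌊(γ : ℝ) ^ n * x⌋, by field_simp, h1, h3⟩ x hxA
    have e : (T^[n] x : ℝ) - y =
        (γ : ℝ) ^ n * (x - ((y : ℝ) + ⌊(γ : ℝ) ^ n * x⌋) / (γ : ℝ) ^ n) := by
      rw [coe_iterate_eq_fract γ T hT x (by omega), Int.fract]
      field_simp
      ring
    rw [e, abs_mul, abs_of_pos hpos]
    calc (1 - 2 * α) * (β * α * ε)
        ≤ (1 - 2 * α) * (r (K + 1 + k + 1) * (γ : ℝ) ^ n) := by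
          have : 0 ≤ 1 - 2 * α := by linarith
          gcongr
      _ = (γ : ℝ) ^ n * ((1 - 2 * α) * r (K + 1 + k + 1)) := by ring
      _ ≤ _ := by gcongr
  refine hc.trans_le (Filter.le_liminf_of_le ?_ (Filter.eventually_atTop.mpr ⟨M + 1, hbound⟩))
  refine Filter.IsBoundedUnder.isCoboundedUnder_ge
    (Filter.isBoundedUnder_of ⟨1, fun n => ?_⟩)
  obtain ⟨h0, h1⟩ := (T^[n] x).2
  obtain ⟨h0', h1'⟩ := y.2
  rw [abs_le]
  constructor <;> linarith
end

section
/- Let T : (0,1) → [0,1) be the Gauss map T(x) = 1/x mod 1 (the fractional part of 1/x), and let ψ = ((1+√5)/2)². There exists a constant R > 0 such that for every positive integer n and every irrational x ∈ (0,1), if the n-th iterate T^n has derivative d at x, then |d| ≥ R · ψ^n. -/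
open Real

theorem Int.hasDerivAt_fract {y : ℝ} (hy : Irrational y) :
    HasDerivAt (Int.fract : ℝ → ℝ) 1 y := by
  have hlt : (⌊y⌋ : ℝ) < y := (Int.floor_le y).lt_of_ne fun h => hy.ne_int _ h.symm
  refine ((hasDerivAt_id y).sub_const (⌊y⌋ : ℝ)).congr_of_eventuallyEq ?_
  filter_upwards [Ioo_mem_nhds hlt (Int.lt_floor_add_one y)] with z hz
  have : ⌊z⌋ = ⌊y⌋ := Int.floor_eq_iff.2 ⟨hz.1.le, hz.2⟩
  simp [Int.fract, this]

theorem hasDerivAt_fract_one_div {x : ℝ} (hx : Irrational x) :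
    HasDerivAt (fun z : ℝ => Int.fract (1 / z)) (-(x ^ 2)⁻¹) x := by
  have h := (Int.hasDerivAt_fract hx.inv).comp x (hasDerivAt_inv hx.ne_zero)
  simpa [Function.comp_def] using h

theorem irrational_fract_one_div {x : ℝ} (hx : Irrational x) :
    Irrational (Int.fract (1 / x)) := by
  rw [one_div]
  exact hx.inv.sub_intCast _

theorem mul_fract_one_div_add_one_le_one {x : ℝ} (hx : x ∈ Set.Ioo (0 : ℝ) 1) :
    x * (Int.fract (1 / x) + 1) ≤ 1 := by
  have hfloor : (1 : ℝ) ≤ ⌊1 / x⌋ := by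
    exact_mod_cast Int.le_floor.2 (by simpa using (one_lt_one_div hx.1 hx.2).le)
  calc x * (Int.fract (1 / x) + 1) ≤ x * (1 / x) := by
        refine mul_le_mul_of_nonneg_left ?_ hx.1.le
        rw [Int.fract]
        linarith
    _ = 1 := mul_one_div_cancel hx.1.ne'

/-- The function `x ↦ x + φ` is a potential for the Gauss map: along an orbit, each factor `x` of
the derivative is at most `φ⁻¹` up to a ratio of consecutive values of the potential. -/
theorem goldenRatio_mul_fract_one_div_add_le {x : ℝ} (hx : x ∈ Set.Ioo (0 : ℝ) 1) :
    goldenRatio * x * (Int.fract (1 / x) + goldenRatio) ≤ x + goldenRatio := by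
  have h := mul_le_mul_of_nonneg_left (mul_fract_one_div_add_one_le_one hx) goldenRatio_pos.le
  linear_combination h + x * goldenRatio_sq

theorem exists_hasDerivAt_gaussMap_iterate {G : ℝ → ℝ} (hG : ∀ x : ℝ, G x = Int.fract (1 / x))
    (n : ℕ) {x : ℝ} (hx : x ∈ Set.Ioo (0 : ℝ) 1) (hirr : Irrational x) :
    ∃ d : ℝ, HasDerivAt (G^[n]) d x ∧ 0 ≤ G^[n] x ∧
      (goldenRatio ^ 2) ^ n * (G^[n] x + goldenRatio) ^ 2 ≤ |d| * (x + goldenRatio) ^ 2 := by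
  induction n generalizing x with
  | zero => exact ⟨1, by simpa using hasDerivAt_id x, by simpa using hx.1.le, by simp⟩
  | succ n ih =>
    have hGirr : Irrational (G x) := hG x ▸ irrational_fract_one_div hirr
    have hG0 : 0 ≤ G x := hG x ▸ Int.fract_nonneg _
    have hG1 : G x < 1 := hG x ▸ Int.fract_lt_one _
    obtain ⟨d, hd, hnonneg, hle⟩ := ih ⟨hG0.lt_of_ne hGirr.ne_zero.symm, hG1⟩ hGirr
    have hGderiv : HasDerivAt G (-(x ^ 2)⁻¹) x := by
      rw [funext hG]
      exact hasDerivAt_fract_one_div hirr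
    refine ⟨_, hd.comp x hGderiv, hnonneg, ?_⟩
    have hx0 := hx.1
    have hφ := goldenRatio_pos
    have hstep : (goldenRatio * x * (G x + goldenRatio)) ^ 2 ≤ (x + goldenRatio) ^ 2 :=
      pow_le_pow_left₀ (by positivity) (hG x ▸ goldenRatio_mul_fract_one_div_add_le hx) 2
    rw [Function.iterate_succ_apply, abs_mul, abs_neg, abs_of_pos (by positivity : 0 < (x ^ 2)⁻¹)]
    calc (goldenRatio ^ 2) ^ (n + 1) * (G^[n] (G x) + goldenRatio) ^ 2
        = goldenRatio ^ 2 * ((goldenRatio ^ 2) ^ n * (G^[n] (G x) + goldenRatio) ^ 2) := by ring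
      _ ≤ goldenRatio ^ 2 * (|d| * (G x + goldenRatio) ^ 2) := by gcongr
      _ = |d| * (x ^ 2)⁻¹ * (goldenRatio * x * (G x + goldenRatio)) ^ 2 := by field_simp
      _ ≤ |d| * (x ^ 2)⁻¹ * (x + goldenRatio) ^ 2 := by gcongr


/-- **Expanding property of the Gauss map.** Let `G` be the Gauss map,
realized as the real function `G x = Int.fract (1 / x)` (note that with the Lean
convention `1 / 0 = 0` this gives `G 0 = 0`, so `G` agrees with the Gauss map
`x ↦ 1/x mod 1` on `(0,1)`).  With `ψ = ((1 + √5)/2)²`, there is a constant `R > 0`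
such that for every `n ≥ 1` and every irrational `x ∈ (0,1)`, any derivative `d` of
the `n`-th iterate `G^[n]` at `x` satisfies `|d| ≥ R * ψ ^ n`. -/
theorem gaussMap_iterate_expanding
    (G : ℝ → ℝ) (hG : ∀ x : ℝ, G x = Int.fract (1 / x)) :
    ∃ R : ℝ, 0 < R ∧ ∀ n : ℕ, 1 ≤ n → ∀ x ∈ Set.Ioo (0:ℝ) 1, Irrational x →
      ∀ d : ℝ, HasDerivAt (G^[n]) d x →
        R * (((1 + Real.sqrt 5) / 2) ^ 2) ^ n ≤ |d| := by
  have hφ := goldenRatio_pos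
  refine ⟨goldenRatio ^ 2 / (1 + goldenRatio) ^ 2, by positivity, fun n _ x hx hirr d hd => ?_⟩
  obtain ⟨d', hd', hnonneg, hle⟩ := exists_hasDerivAt_gaussMap_iterate hG n hx hirr
  obtain rfl := hd.unique hd'
  have hx0 := hx.1
  change _ * (goldenRatio ^ 2) ^ n ≤ |d|
  rw [div_mul_eq_mul_div, div_le_iff₀ (by positivity)]
  calc goldenRatio ^ 2 * (goldenRatio ^ 2) ^ n
      = (goldenRatio ^ 2) ^ n * (0 + goldenRatio) ^ 2 := by ring
    _ ≤ (goldenRatio ^ 2) ^ n * (G^[n] x + goldenRatio) ^ 2 := by gcongr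
    _ ≤ |d| * (x + goldenRatio) ^ 2 := hle
    _ ≤ |d| * (1 + goldenRatio) ^ 2 := by gcongr; exact hx.2.le
end
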